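/- Let p ≥ 1, T > 0, and let u : ℝ × (0,T) → ℝ be a smooth, strictly positive solution of ∂_t u = −∂_x²( u^p ∂_x²(ln_p u) ) such that for every t the function u(·,t) is a probability density which, together with all its spatial derivatives, decays faster than any polynomial as |x| → ∞ and has finite second moment Θ(t) = ∫_ℝ x² u(x,t) dx. Then t ↦ Θ(t) is differentiable on (0,T) and dΘ/dt = 4p · I_p(u(·,t)) = 2p ∫_ℝ u ( d/dx (ln_p u) )² dx for every t ∈ (0,T). -/

import Mathlib

open MeasureTheory Filter Set

/-- The `p`-logarithm: `ln_p u = (u^(p-1) - 1)/(p-1)` for `p ≠ 1`, and `ln u` for `p = 1`. -/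
noncomputable def lnp (p : ℝ) (u : ℝ) : ℝ :=
  if p = 1 then Real.log u else (u ^ (p - 1) - 1) / (p - 1)

/-- Generalized Fisher information `I_p(f) = (1/2) ∫ f ((ln_p f)')²`. -/
noncomputable def fisherP (p : ℝ) (f : ℝ → ℝ) : ℝ :=
  (1 / 2) * ∫ x : ℝ, f x * (deriv (fun y => lnp p (f y)) x) ^ 2

/-- Rényi entropy of order `p ≠ 1`: `R_p(f) = (1/(1-p)) ln ∫ f^p`. -/
noncomputable def renyi (p : ℝ) (f : ℝ → ℝ) : ℝ :=
  (1 / (1 - p)) * Real.log (∫ x : ℝ, f x ^ p)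

/-- `f`, together with all its derivatives, decays faster than any polynomial at infinity. -/
def RapidDecay (f : ℝ → ℝ) : Prop :=
  ∀ n k : ℕ, Tendsto (fun x => x ^ n * iteratedDeriv k f x) (cocompact ℝ) (nhds 0)

/-- `χ` is a compactly supported `C²` cutoff with values in `[0, 1]`, with derivatives `χ₁`, `χ₂`
bounded by `δ`. -/
structure IsCutoff (δ : ℝ) (χ χ₁ χ₂ : ℝ → ℝ) : Prop where
  hasDerivAt : ∀ x, HasDerivAt χ (χ₁ x) x
  hasDerivAt₁ : ∀ x, HasDerivAt χ₁ (χ₂ x) x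
  continuous₂ : Continuous χ₂
  compact : HasCompactSupport χ
  nonneg : ∀ x, 0 ≤ χ x
  le_one : ∀ x, χ x ≤ 1
  abs_le₁ : ∀ x, |χ₁ x| ≤ δ
  abs_le₂ : ∀ x, |χ₂ x| ≤ δ

/-- A positive density `u` together with `a = u ^ (p - 1)`, the derivative `w` of `ln_p u`, the
first two derivatives `w₁`, `w₂` of `w`, and the derivative `v` of the flux `(u ^ p w₁)'`. -/
structure IsProfile (p : ℝ) (u a w w₁ w₂ v : ℝ → ℝ) : Prop where
  pos : ∀ x, 0 < u x
  a_eq : ∀ x, a x = u x ^ (p - 1)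
  continuous_u : Continuous u
  continuous_a : Continuous a
  hasDerivAt_ua : ∀ x, HasDerivAt (fun y => u y * a y) (p * (u x * w x)) x
  hasDerivAt_a : ∀ x, HasDerivAt a ((p - 1) * w x) x
  hasDerivAt_w : ∀ x, HasDerivAt w (w₁ x) x
  hasDerivAt_w₁ : ∀ x, HasDerivAt w₁ (w₂ x) x
  continuous_w₂ : Continuous w₂
  hasDerivAt_flux : ∀ x, HasDerivAt (fun y => u y * (a y * w₂ y + p * (w y * w₁ y))) (v x) x
  continuous_v : Continuous v
  integrable : Integrable u
  integral_eq : ∫ x, u x = 1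

theorem IsCutoff.continuous {δ : ℝ} {χ χ₁ χ₂ : ℝ → ℝ} (hc : IsCutoff δ χ χ₁ χ₂) :
    Continuous χ :=
  continuous_iff_continuousAt.2 fun x => (hc.hasDerivAt x).continuousAt

theorem IsCutoff.continuous₁ {δ : ℝ} {χ χ₁ χ₂ : ℝ → ℝ} (hc : IsCutoff δ χ χ₁ χ₂) :
    Continuous χ₁ :=
  continuous_iff_continuousAt.2 fun x => (hc.hasDerivAt₁ x).continuousAt

theorem IsProfile.continuous_w {p : ℝ} {u a w w₁ w₂ v : ℝ → ℝ}
    (h : IsProfile p u a w w₁ w₂ v) : Continuous w :=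
  continuous_iff_continuousAt.2 fun x => (h.hasDerivAt_w x).continuousAt

theorem IsProfile.continuous_w₁ {p : ℝ} {u a w w₁ w₂ v : ℝ → ℝ}
    (h : IsProfile p u a w w₁ w₂ v) : Continuous w₁ :=
  continuous_iff_continuousAt.2 fun x => (h.hasDerivAt_w₁ x).continuousAt

theorem IsProfile.a_pos {p : ℝ} {u a w w₁ w₂ v : ℝ → ℝ}
    (h : IsProfile p u a w w₁ w₂ v) (x : ℝ) : 0 < a x := by
  rw [h.a_eq]; exact Real.rpow_pos_of_pos (h.pos x) _

theorem IsCutoff.compactSupport_of_zero {δ : ℝ} {χ χ₁ χ₂ : ℝ → ℝ} (hc : IsCutoff δ χ χ₁ χ₂)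
    {f : ℝ → ℝ} (h0 : ∀ x, χ x = 0 → f x = 0) : HasCompactSupport f :=
  hc.compact.mono fun x hx h => hx (h0 x h)

theorem IsCutoff.integrable {δ : ℝ} {χ χ₁ χ₂ : ℝ → ℝ} (hc : IsCutoff δ χ χ₁ χ₂)
    {f : ℝ → ℝ} (hf : Continuous f) (h0 : ∀ x, χ x = 0 → f x = 0) : Integrable f :=
  hf.integrable_of_hasCompactSupport (hc.compactSupport_of_zero h0)

/-- An integral inequality follows from a pointwise one up to a total derivative. -/
theorem IsCutoff.integral_le_of_le_deriv_add {δ : ℝ} {χ χ₁ χ₂ : ℝ → ℝ}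
    (hc : IsCutoff δ χ χ₁ χ₂) {g g' f f₁ f₂ f₃ : ℝ → ℝ} {c₁ c₂ c₃ : ℝ}
    (hg : ∀ x, HasDerivAt g (g' x) x) (hg' : Continuous g')
    (hg0 : ∀ x, χ x = 0 → g x = 0) (hg0' : ∀ x, χ x = 0 → g' x = 0)
    (hf : Integrable f) (hf₁ : Integrable f₁) (hf₂ : Integrable f₂) (hf₃ : Integrable f₃)
    (h : ∀ x, f x ≤ g' x + c₁ * f₁ x + c₂ * f₂ x + c₃ * f₃ x) :
    ∫ x, f x ≤ c₁ * (∫ x, f₁ x) + c₂ * (∫ x, f₂ x) + c₃ * ∫ x, f₃ x := by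
  have hgc : Continuous g := continuous_iff_continuousAt.2 fun x => (hg x).continuousAt
  have hi' := hc.integrable hg' hg0'
  have hz := integral_eq_zero_of_hasDerivAt_of_integrable hg hi' (hc.integrable hgc hg0)
  have hi1 : Integrable fun x => g' x + c₁ * f₁ x := hi'.add (hf₁.const_mul _)
  have hi2 : Integrable fun x => g' x + c₁ * f₁ x + c₂ * f₂ x := hi1.add (hf₂.const_mul _)
  calc ∫ x, f x ≤ ∫ x, (g' x + c₁ * f₁ x + c₂ * f₂ x + c₃ * f₃ x) :=
        integral_mono hf (hi2.add (hf₃.const_mul _)) h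
    _ = _ := by
        rw [integral_add hi2 (hf₃.const_mul _), integral_add hi1 (hf₂.const_mul _),
          integral_add hi' (hf₁.const_mul _), hz]
        simp [integral_const_mul]

theorem norm_le_integral_norm_deriv {g g' : ℝ → ℝ} (hg : ∀ x, HasDerivAt g (g' x) x)
    (hg' : Continuous g') (hs : HasCompactSupport g) (x : ℝ) : |g x| ≤ ∫ y, |g' y| := by
  have hd : deriv g = g' := funext fun y => (hg y).deriv
  have hC : ContDiff ℝ 1 g :=
    contDiff_one_iff_deriv.2 ⟨fun y => (hg y).differentiableAt, hd ▸ hg'⟩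
  have hi : Integrable g' := hg'.integrable_of_hasCompactSupport (hd ▸ hs.deriv)
  rw [← HasCompactSupport.integral_Iic_deriv_eq hC hs x, hd]
  calc |∫ y in Iic x, g' y| ≤ ∫ y in Iic x, |g' y| := by
        simpa using norm_integral_le_integral_norm (μ := volume.restrict (Iic x)) g'
    _ ≤ ∫ y, |g' y| :=
        setIntegral_le_integral hi.abs (Eventually.of_forall fun y => abs_nonneg _)

theorem absorption {K : ℝ} (hK : 1 ≤ K) : ∃ C δ₀ : ℝ, 0 < C ∧ 0 < δ₀ ∧
    ∀ D G W τ δ : ℝ, 0 ≤ D → 0 ≤ G → 0 ≤ W → 0 ≤ δ → δ ≤ δ₀ → 1 ≤ τ → W ≤ τ ^ 2 →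
      τ ^ 2 ≤ 2 + 2 * W →
      (∀ μ, 0 < μ → W ≤ K * (μ * G + τ / μ + δ ^ 2 * τ ^ 2)) →
      (∀ μ, 0 < μ → G ≤ K * (μ * D + W / μ + δ ^ 2 * τ ^ 3)) →
      τ * G ≤ C * (1 + D) ∧ τ ^ 2 * W ≤ C * (1 + D) := by
  have hK0 : 0 < K := by linarith
  refine ⟨2 * (138 * K ^ 2) ^ 2 + 132000 * K ^ 6, 1 / (16 * K ^ 2), by positivity, by positivity, ?_⟩
  intro D G W τ δ hD hG hW hδ hδ₀ hτ hWτ hτW h1 h2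
  have hτ0 : 0 < τ := by linarith
  have hδ2 : δ ^ 2 * (256 * K ^ 4) ≤ 1 := by
    have : δ * (16 * K ^ 2) ≤ 1 := by
      rwa [le_div_iff₀ (by positivity)] at hδ₀
    calc δ ^ 2 * (256 * K ^ 4) = (δ * (16 * K ^ 2)) ^ 2 := by ring
      _ ≤ 1 := pow_le_one₀ (by positivity) this
  have hKK : K ≤ K ^ 4 := le_self_pow₀ hK (by norm_num)
  have hK3 : K ^ 3 ≤ K ^ 4 := pow_le_pow_right₀ hK (by norm_num)
  have hδK : K * δ ^ 2 ≤ 1 / 256 := by nlinarith [sq_nonneg δ]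
  have hδK3 : K ^ 3 * δ ^ 2 ≤ 1 / 256 := by nlinarith [sq_nonneg δ]
  have hτ3 : τ ^ 3 ≤ 10 + 64 * K ^ 2 * G := by
    have := h1 (8 * K / τ) (by positivity)
    have e : K * (8 * K / τ * G + τ / (8 * K / τ) + δ ^ 2 * τ ^ 2)
        = 8 * K ^ 2 * G / τ + τ ^ 2 / 8 + K * δ ^ 2 * τ ^ 2 := by field_simp
    rw [e] at this
    have h3 : K * δ ^ 2 * τ ^ 2 ≤ 1 / 256 * τ ^ 2 := by gcongr
    have h4 : τ ^ 2 ≤ 4 + 32 * (K ^ 2 * G / τ) := by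
      have : 8 * K ^ 2 * G / τ = 8 * (K ^ 2 * G / τ) := by ring
      nlinarith
    have h5 : τ * τ ^ 2 ≤ τ * (4 + 32 * (K ^ 2 * G / τ)) := by gcongr
    have e2 : τ * (4 + 32 * (K ^ 2 * G / τ)) = 4 * τ + 32 * K ^ 2 * G := by field_simp
    nlinarith [mul_nonneg hτ0.le (sq_nonneg (τ - 2)), sq_nonneg (τ - 2), sq_nonneg (τ - 1)]
  have hτG : τ * G ≤ 512 * K ^ 4 * D + 2 * τ := by
    have := h2 (256 * K ^ 3 / τ) (by positivity)
    have e : K * (256 * K ^ 3 / τ * D + W / (256 * K ^ 3 / τ) + δ ^ 2 * τ ^ 3)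
        = 256 * K ^ 4 * D / τ + W * τ / (256 * K ^ 2) + K * δ ^ 2 * τ ^ 3 := by field_simp
    rw [e] at this
    have h3 : W * τ / (256 * K ^ 2) ≤ 1 / 2 + G / 4 := by
      rw [div_le_iff₀ (by positivity)]
      have : W * τ ≤ τ ^ 3 := by nlinarith
      have : (1:ℝ) ≤ K ^ 2 := one_le_pow₀ hK
      nlinarith
    have h4 : K * δ ^ 2 * τ ^ 3 ≤ 1 / 2 + G / 4 := by
      calc K * δ ^ 2 * τ ^ 3 ≤ K * δ ^ 2 * (10 + 64 * K ^ 2 * G) := by gcongr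
        _ = 10 * (K * δ ^ 2) + 64 * (K ^ 3 * δ ^ 2) * G := by ring
        _ ≤ 10 * (1 / 256) + 64 * (1 / 256) * G := by gcongr
        _ ≤ _ := by linarith
    have h5 : G ≤ 512 * (K ^ 4 * D / τ) + 2 := by
      have : 256 * K ^ 4 * D / τ = 256 * (K ^ 4 * D / τ) := by ring
      linarith
    have h6 : τ * G ≤ τ * (512 * (K ^ 4 * D / τ) + 2) := by gcongr
    have e2 : τ * (512 * (K ^ 4 * D / τ) + 2) = 512 * K ^ 4 * D + 2 * τ := by field_simp
    have : 0 ≤ K ^ 4 * D := by positivity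
    linarith
  have hK24 : K ^ 4 ≤ K ^ 6 := pow_le_pow_right₀ hK (by norm_num)
  have hτ4 : τ ^ 4 ≤ (138 * K ^ 2) ^ 2 + 65536 * K ^ 6 * D := by
    have h3 : τ * τ ^ 3 ≤ τ * (10 + 64 * K ^ 2 * G) := by gcongr
    have h4 : K ^ 2 * (τ * G) ≤ K ^ 2 * (512 * K ^ 4 * D + 2 * τ) := by gcongr
    have h5 : 1 * τ ≤ K ^ 2 * τ := by
      gcongr
      exact one_le_pow₀ hK
    have h6 : K ^ 2 * τ ≤ K ^ 2 * τ ^ 2 := by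
      gcongr
      nlinarith
    nlinarith [sq_nonneg (τ ^ 2 - 138 * K ^ 2)]
  have hDK : K ^ 4 * D ≤ K ^ 6 * D := by gcongr
  have hτ1 : τ ≤ τ ^ 4 := le_self_pow₀ hτ (by norm_num)
  have hWτ4 : τ ^ 2 * W ≤ τ ^ 4 := by
    calc τ ^ 2 * W ≤ τ ^ 2 * τ ^ 2 := by gcongr
      _ = τ ^ 4 := by ring
  have hn1 : 0 ≤ K ^ 6 * D := by positivity
  have hn2 : 0 ≤ (138 * K ^ 2) ^ 2 * D := by positivity
  have hn3 : 0 ≤ K ^ 6 := by positivity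
  have hn4 : 0 ≤ (138 * K ^ 2) ^ 2 := by positivity
  constructor <;> linarith

section FixedTime

variable {p δ : ℝ} {u a w w₁ w₂ v χ χ₁ χ₂ : ℝ → ℝ}

theorem IsCutoff.hasDerivAt_pow (hc : IsCutoff δ χ χ₁ χ₂) (n : ℕ) (x : ℝ) :
    HasDerivAt (fun y => χ y ^ (n + 1)) ((n + 1 : ℝ) * (χ x ^ n * χ₁ x)) x := by
  have := (hc.hasDerivAt x).pow (n + 1)
  rw [Nat.add_sub_cancel, mul_assoc] at this
  exact_mod_cast this

theorem weighted_rpow_le {c u p : ℝ} {q : ℕ} (hc0 : 0 ≤ c) (hc1 : c ≤ 1) (hu : 0 < u) (hq : p - 1 ≤ q)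
    (hp : 1 ≤ p) : c ^ (2 * q) * u ^ (p - 1) ≤
      1 + c ^ (2 * q + 2) * (u * u ^ (p - 1)) := by
  have ha : 0 < u ^ (p - 1) := Real.rpow_pos_of_pos hu _
  rcases le_or_gt 1 (c ^ 2 * u) with h | h
  · have : c ^ (2 * q) * u ^ (p - 1) * 1 ≤ c ^ (2 * q) * u ^ (p - 1) * (c ^ 2 * u) := by gcongr
    calc _ ≤ c ^ (2 * q) * u ^ (p - 1) * (c ^ 2 * u) := by linarith
      _ = c ^ (2 * q + 2) * (u * u ^ (p - 1)) := by ring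
      _ ≤ _ := by linarith
  · have h1 : c ^ (2 * q) * u ^ (p - 1) ≤ 1 := by
      by_cases hu1 : 1 ≤ u
      · calc c ^ (2 * q) * u ^ (p - 1) ≤ c ^ (2 * q) * u ^ (q : ℝ) := by gcongr
          _ = (c ^ 2 * u) ^ q := by rw [Real.rpow_natCast, mul_pow, pow_mul]
          _ ≤ 1 := pow_le_one₀ (by positivity) h.le
      · exact mul_le_one₀ (pow_le_one₀ hc0 hc1) ha.le
          (Real.rpow_le_one hu.le (by linarith) (by linarith))
    have : 0 ≤ c ^ (2 * q + 2) * (u * u ^ (p - 1)) := by positivity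
    linarith

/-- Bound on the weighted supremum of `u ^ (p - 1)` by the Fisher information and the mass. -/
theorem weighted_sup_le (hp : 1 ≤ p) {q : ℕ} (hq : p - 1 ≤ q)
    (h : IsProfile p u a w w₁ w₂ v) (hc : IsCutoff δ χ χ₁ χ₂)
    (hδ : (2 * q + 2 : ℝ) * δ ≤ 1 / 2) {τ : ℝ} (hτ : 1 ≤ τ)
    (hW : ∫ x, χ x ^ (4 * q + 4) * (u x * w x ^ 2) ≤ τ ^ 2) (x : ℝ) :
    χ x ^ (2 * q) * a x ≤ (2 + 2 * p) * τ := by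
  have hδ0 : 0 ≤ δ := (abs_nonneg _).trans (hc.abs_le₁ 0)
  have cu := h.continuous_u
  have ca := h.continuous_a
  have cw := h.continuous_w
  have cχ := hc.continuous
  have cχ₁ := hc.continuous₁
  obtain ⟨x₀, hx₀⟩ : ∃ x₀, ∀ y, χ y ^ (2 * q + 2) * (u y * a y)
      ≤ χ x₀ ^ (2 * q + 2) * (u x₀ * a x₀) := by
    have hcs : HasCompactSupport fun y => χ y ^ (2 * q + 2) * (u y * a y) :=
      hc.compactSupport_of_zero fun x hx => by simp [hx]
    exact Continuous.exists_forall_ge_of_hasCompactSupport (by fun_prop) hcs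
  set N := χ x₀ ^ (2 * q + 2) * (u x₀ * a x₀) with hN
  have hle : ∀ y, χ y ^ (2 * q) * a y ≤ 1 + N := fun y => by
    have := weighted_rpow_le (hc.nonneg y) (hc.le_one y) (h.pos y) hq hp
    rw [← h.a_eq] at this
    linarith [hx₀ y]
  have hN0 : 0 ≤ N := by
    have := h.pos x₀; have := h.a_pos x₀; have := hc.nonneg x₀
    positivity
  have hd : ∀ y, HasDerivAt (fun y => χ y ^ (2 * q + 1 + 1) * (u y * a y))
      ((2 * q + 1 + 1 : ℝ) * (χ y ^ (2 * q + 1) * χ₁ y) * (u y * a y)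
        + χ y ^ (2 * q + 1 + 1) * (p * (u y * w y))) y := fun y => by
    have := (hc.hasDerivAt_pow (2 * q + 1) y).mul (h.hasDerivAt_ua y)
    push_cast at this
    exact this
  have hb := norm_le_integral_norm_deriv hd (by fun_prop)
    (hc.compactSupport_of_zero fun x hx => by simp [hx]) x₀
  have hiW : Integrable fun x => χ x ^ (4 * q + 4) * (u x * w x ^ 2) :=
    hc.integrable (by fun_prop) fun x hx => by simp [hx]
  have hNle : N ≤ ((2 * q + 2) * δ * (1 + N) + p * τ / 2) * 1 + p / (2 * τ) * τ ^ 2 := by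
    calc N ≤ |χ x₀ ^ (2 * q + 1 + 1) * (u x₀ * a x₀)| := le_abs_self _
      _ ≤ _ := hb
      _ ≤ ∫ y, (((2 * q + 2) * δ * (1 + N) + p * τ / 2) * u y
            + p / (2 * τ) * (χ y ^ (4 * q + 4) * (u y * w y ^ 2))) := by
          refine integral_mono_of_nonneg (Eventually.of_forall fun y => abs_nonneg _)
            ((h.integrable.const_mul _).add (hiW.const_mul _)) (Eventually.of_forall fun y => ?_)
          have hu := h.pos y
          have ha := h.a_pos y
          have hχ := hc.nonneg y
          have h1 : χ y ^ (2 * q + 1) * a y ≤ 1 + N := by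
            refine le_trans ?_ (hle y)
            exact mul_le_mul_of_nonneg_right
              (pow_le_pow_of_le_one hχ (hc.le_one y) (Nat.le_succ (2 * q))) ha.le
          have h2 : |(2 * q + 1 + 1 : ℝ) * (χ y ^ (2 * q + 1) * χ₁ y) * (u y * a y)|
              ≤ (2 * q + 2) * δ * (1 + N) * u y := by
            have e : |(2 * q + 1 + 1 : ℝ) * (χ y ^ (2 * q + 1) * χ₁ y) * (u y * a y)|
              = (2 * q + 2) * |χ₁ y| * (χ y ^ (2 * q + 1) * a y) * u y := by
              simp only [abs_mul, abs_pow, abs_of_pos hu, abs_of_pos ha, abs_of_nonneg hχ]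
              rw [abs_of_nonneg (by positivity)]
              ring
            rw [e]
            have := hc.abs_le₁ y
            gcongr
          have h3 : |χ y ^ (2 * q + 1 + 1) * (p * (u y * w y))|
              ≤ p * τ / 2 * u y + p / (2 * τ) * (χ y ^ (4 * q + 4) * (u y * w y ^ 2)) := by
            have e : |χ y ^ (2 * q + 1 + 1) * (p * (u y * w y))|
              = p * u y * |χ y ^ (2 * q + 2) * w y| := by
              simp only [abs_mul, abs_pow, abs_of_pos hu, abs_of_nonneg hχ]
              rw [abs_of_nonneg (by positivity : (0:ℝ) ≤ p)]
              ring
            have e2 : p * τ / 2 * u y + p / (2 * τ) * (χ y ^ (4 * q + 4) * (u y * w y ^ 2))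
              = p * u y * ((τ ^ 2 + |χ y ^ (2 * q + 2) * w y| ^ 2) / (2 * τ)) := by
              rw [sq_abs]
              field_simp
              ring
            rw [e, e2]
            gcongr
            rw [le_div_iff₀ (by positivity)]
            nlinarith [sq_nonneg (τ - |χ y ^ (2 * q + 2) * w y|)]
          calc _ ≤ _ := abs_add_le _ _
            _ ≤ _ := add_le_add h2 h3
            _ = _ := by ring
      _ = ((2 * q + 2) * δ * (1 + N) + p * τ / 2) * 1
            + p / (2 * τ) * ∫ y, χ y ^ (4 * q + 4) * (u y * w y ^ 2) := by
          rw [integral_add (h.integrable.const_mul _) (hiW.const_mul _), integral_const_mul,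
            integral_const_mul, h.integral_eq]
      _ ≤ _ := by gcongr
  have e : p / (2 * τ) * τ ^ 2 = p * τ / 2 := by field_simp
  rw [e] at hNle
  have : (2 * q + 2) * δ * (1 + N) ≤ 1 / 2 * (1 + N) := by gcongr
  linarith [hle x]
theorem fisher_le (hp : 1 ≤ p) {q : ℕ}
    (h : IsProfile p u a w w₁ w₂ v) (hc : IsCutoff δ χ χ₁ χ₂) {S : ℝ}
    (hS : ∀ x, χ x ^ (2 * q) * a x ≤ S) {μ : ℝ} (hμ : 0 < μ) :
    ∫ x, χ x ^ (4 * q + 4) * (u x * w x ^ 2) ≤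
      2 * μ * (∫ x, χ x ^ (6 * q + 6) * (u x * (a x * w₁ x ^ 2)))
        + (S / (2 * μ) + (4 * q + 4) ^ 2 * δ ^ 2 * S ^ 2) := by
  have cu := h.continuous_u
  have ca := h.continuous_a
  have cw := h.continuous_w
  have cw₁ := h.continuous_w₁
  have cχ := hc.continuous
  have cχ₁ := hc.continuous₁
  have hd : ∀ x, HasDerivAt (fun y => 2 * (χ y ^ (4 * q + 3 + 1) * (w y * (u y * a y))))
      (2 * ((4 * q + 3 + 1 : ℝ) * (χ x ^ (4 * q + 3) * χ₁ x) * (w x * (u x * a x))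
        + χ x ^ (4 * q + 3 + 1) * (w₁ x * (u x * a x) + w x * (p * (u x * w x))))) x := fun x => by
    have := ((hc.hasDerivAt_pow (4 * q + 3) x).mul
      ((h.hasDerivAt_w x).mul (h.hasDerivAt_ua x))).const_mul 2
    push_cast at this
    exact this
  have hI1 : Integrable fun x => χ x ^ (4 * q + 4) * (u x * w x ^ 2) :=
    hc.integrable (by fun_prop) fun x hx => by simp [hx]
  have hI2 : Integrable fun x => χ x ^ (6 * q + 6) * (u x * (a x * w₁ x ^ 2)) :=
    hc.integrable (by fun_prop) fun x hx => by simp [hx]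
  have key := hc.integral_le_of_le_deriv_add (c₁ := 2 * μ)
    (c₂ := S / (2 * μ) + (4 * q + 4) ^ 2 * δ ^ 2 * S ^ 2) (c₃ := 0)
    hd (by fun_prop) (fun x hx => by simp [hx]) (fun x hx => by simp [hx]) hI1 hI2 h.integrable
    h.integrable fun x => ?_
  · rw [h.integral_eq] at key
    linarith
  have hu := h.pos x
  have ha := h.a_pos x
  have hχ := hc.nonneg x
  have hSx := hS x
  have hδx := sq_le_sq' (abs_le.1 (hc.abs_le₁ x)).1 (abs_le.1 (hc.abs_le₁ x)).2
  have hχ1 := hc.le_one x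
  generalize u x = U at *
  generalize a x = A at *
  generalize w x = ω at *
  generalize w₁ x = ω₁ at *
  generalize χ₁ x = d at *
  generalize χ x = c at *
  have he : 0 ≤ c ^ (2 * q) := by positivity
  rw [show c ^ (4 * q + 4) = (c ^ (2 * q)) ^ 2 * c ^ 4 by ring,
    show c ^ (6 * q + 6) = (c ^ (2 * q)) ^ 3 * c ^ 6 by ring,
    show c ^ (4 * q + 3) = (c ^ (2 * q)) ^ 2 * c ^ 3 by ring]
  generalize c ^ (2 * q) = e at *
  have hc2 : c ^ 2 ≤ 1 := pow_le_one₀ hχ hχ1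
  have hS0 : 0 ≤ S := le_trans (by positivity) hSx
  have t1 : -2 * (e ^ 2 * c ^ 4 * (ω₁ * (U * A))) ≤
      2 * μ * (e ^ 3 * c ^ 6 * (U * (A * ω₁ ^ 2))) + S / (2 * μ) * U := by
    have i1 : -2 * (e ^ 2 * c ^ 4 * (ω₁ * (U * A))) ≤
        2 * μ * (e ^ 3 * c ^ 6 * (U * (A * ω₁ ^ 2))) + e * A * c ^ 2 * U / (2 * μ) := by
      have : 0 ≤ e * A * c ^ 2 * U / (2 * μ) * (2 * μ * (e * c ^ 2 * ω₁) + 1) ^ 2 := by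
        positivity
      have e1 : e * A * c ^ 2 * U / (2 * μ) * (2 * μ * (e * c ^ 2 * ω₁) + 1) ^ 2 =
          2 * μ * (e ^ 3 * c ^ 6 * (U * (A * ω₁ ^ 2))) + e * A * c ^ 2 * U / (2 * μ)
            + 2 * (e ^ 2 * c ^ 4 * (ω₁ * (U * A))) := by
        field_simp
        ring
      linarith
    have i2 : e * A * c ^ 2 * U / (2 * μ) ≤ S * 1 * U / (2 * μ) := by gcongr
    have e2 : S * 1 * U / (2 * μ) = S / (2 * μ) * U := by ring
    linarith
  have t2 : -2 * ((4 * q + 4 : ℝ) * (e ^ 2 * c ^ 3 * d) * (ω * (U * A))) ≤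
      e ^ 2 * c ^ 4 * (U * ω ^ 2) + (4 * q + 4) ^ 2 * δ ^ 2 * S ^ 2 * U := by
    have i1 : -2 * ((4 * q + 4 : ℝ) * (e ^ 2 * c ^ 3 * d) * (ω * (U * A))) ≤
        e ^ 2 * c ^ 4 * (U * ω ^ 2) + (4 * q + 4) ^ 2 * d ^ 2 * ((e * A) ^ 2 * c ^ 2) * U := by
      have : 0 ≤ U * (e * c ^ 2 * ω + (4 * q + 4 : ℝ) * d * (e * A * c)) ^ 2 := by positivity
      linarith
    have i2 : (4 * q + 4 : ℝ) ^ 2 * d ^ 2 * ((e * A) ^ 2 * c ^ 2) * U ≤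
        (4 * q + 4 : ℝ) ^ 2 * δ ^ 2 * (S ^ 2 * 1) * U := by gcongr
    linarith
  have t3 : e ^ 2 * c ^ 4 * (U * ω ^ 2) ≤ p * (e ^ 2 * c ^ 4 * (U * ω ^ 2)) :=
    le_mul_of_one_le_left (by positivity) hp
  linarith

theorem curvature_le {q : ℕ}
    (h : IsProfile p u a w w₁ w₂ v) (hc : IsCutoff δ χ χ₁ χ₂) {S : ℝ}
    (hS : ∀ x, χ x ^ (2 * q) * a x ≤ S) {μ : ℝ} (hμ : 0 < μ)
    (hJ : ∀ x, HasDerivAt (fun y => u y * a y * w₁ y)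
      (u x * (a x * w₂ x + p * (w x * w₁ x))) x) :
    ∫ x, χ x ^ (6 * q + 6) * (u x * (a x * w₁ x ^ 2)) ≤
      2 * μ * (∫ x, χ x ^ (8 * q + 8) * (u x * (a x * w₂ x + p * (w x * w₁ x)) ^ 2))
        + (1 / (2 * μ) + (6 * q + 6) ^ 2 * δ ^ 2 * S)
          * (∫ x, χ x ^ (4 * q + 4) * (u x * w x ^ 2)) := by
  have cu := h.continuous_u
  have ca := h.continuous_a
  have cw := h.continuous_w
  have cw₁ := h.continuous_w₁
  have cw₂ := h.continuous_w₂
  have cχ := hc.continuous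
  have cχ₁ := hc.continuous₁
  have hd : ∀ x, HasDerivAt (fun y => 2 * (χ y ^ (6 * q + 5 + 1) * (w y * (u y * a y * w₁ y))))
      (2 * ((6 * q + 5 + 1 : ℝ) * (χ x ^ (6 * q + 5) * χ₁ x) * (w x * (u x * a x * w₁ x))
        + χ x ^ (6 * q + 5 + 1) * (w₁ x * (u x * a x * w₁ x)
          + w x * (u x * (a x * w₂ x + p * (w x * w₁ x)))))) x := fun x => by
    have := ((hc.hasDerivAt_pow (6 * q + 5) x).mul
      ((h.hasDerivAt_w x).mul (hJ x))).const_mul 2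
    push_cast at this
    exact this
  have hI1 : Integrable fun x => χ x ^ (6 * q + 6) * (u x * (a x * w₁ x ^ 2)) :=
    hc.integrable (by fun_prop) fun x hx => by simp [hx]
  have hI2 : Integrable fun x =>
      χ x ^ (8 * q + 8) * (u x * (a x * w₂ x + p * (w x * w₁ x)) ^ 2) :=
    hc.integrable (by fun_prop) fun x hx => by simp [hx]
  have hI3 : Integrable fun x => χ x ^ (4 * q + 4) * (u x * w x ^ 2) :=
    hc.integrable (by fun_prop) fun x hx => by simp [hx]
  have key := hc.integral_le_of_le_deriv_add (c₁ := 2 * μ)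
    (c₂ := 1 / (2 * μ) + (6 * q + 6) ^ 2 * δ ^ 2 * S) (c₃ := 0)
    hd (by fun_prop) (fun x hx => by simp [hx]) (fun x hx => by simp [hx]) hI1 hI2 hI3 hI3
    fun x => ?_
  · linarith
  have hu := h.pos x
  have ha := h.a_pos x
  have hχ := hc.nonneg x
  have hSx := hS x
  have hδx := sq_le_sq' (abs_le.1 (hc.abs_le₁ x)).1 (abs_le.1 (hc.abs_le₁ x)).2
  generalize a x * w₂ x + p * (w x * w₁ x) = r at *
  generalize u x = U at *
  generalize a x = A at *
  generalize w x = ω at *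
  generalize w₁ x = ω₁ at *
  generalize χ₁ x = d at *
  generalize χ x = c at *
  have he : 0 ≤ c ^ (2 * q) := by positivity
  rw [show c ^ (4 * q + 4) = (c ^ (2 * q)) ^ 2 * c ^ 4 by ring,
    show c ^ (6 * q + 6) = (c ^ (2 * q)) ^ 3 * c ^ 6 by ring,
    show c ^ (8 * q + 8) = (c ^ (2 * q)) ^ 4 * c ^ 8 by ring,
    show c ^ (6 * q + 5) = (c ^ (2 * q)) ^ 3 * c ^ 5 by ring]
  generalize c ^ (2 * q) = e at *
  have hS0 : 0 ≤ S := le_trans (by positivity) hSx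
  have t1 : -2 * (e ^ 3 * c ^ 6 * (ω * (U * r))) ≤
      2 * μ * (e ^ 4 * c ^ 8 * (U * r ^ 2)) + 1 / (2 * μ) * (e ^ 2 * c ^ 4 * (U * ω ^ 2)) := by
    have : 0 ≤ e ^ 2 * c ^ 4 * U / (2 * μ) * (2 * μ * (e * c ^ 2 * r) + ω) ^ 2 := by
      positivity
    have e1 : e ^ 2 * c ^ 4 * U / (2 * μ) * (2 * μ * (e * c ^ 2 * r) + ω) ^ 2 =
        2 * μ * (e ^ 4 * c ^ 8 * (U * r ^ 2)) + 1 / (2 * μ) * (e ^ 2 * c ^ 4 * (U * ω ^ 2))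
          + 2 * (e ^ 3 * c ^ 6 * (ω * (U * r))) := by
      field_simp
      ring
    linarith
  have t2 : -2 * ((6 * q + 6 : ℝ) * (e ^ 3 * c ^ 5 * d) * (ω * (U * A * ω₁))) ≤
      e ^ 3 * c ^ 6 * (U * (A * ω₁ ^ 2))
        + (6 * q + 6) ^ 2 * δ ^ 2 * S * (e ^ 2 * c ^ 4 * (U * ω ^ 2)) := by
    have i1 : -2 * ((6 * q + 6 : ℝ) * (e ^ 3 * c ^ 5 * d) * (ω * (U * A * ω₁))) ≤
        e ^ 3 * c ^ 6 * (U * (A * ω₁ ^ 2))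
        + (6 * q + 6) ^ 2 * d ^ 2 * (e * A) * (e ^ 2 * c ^ 4 * (U * ω ^ 2)) := by
      have : 0 ≤ e ^ 3 * c ^ 4 * U * A * (c * ω₁ + (6 * q + 6 : ℝ) * d * ω) ^ 2 := by positivity
      linarith
    have i2 : (6 * q + 6 : ℝ) ^ 2 * d ^ 2 * (e * A) * (e ^ 2 * c ^ 4 * (U * ω ^ 2)) ≤
        (6 * q + 6 : ℝ) ^ 2 * δ ^ 2 * S * (e ^ 2 * c ^ 4 * (U * ω ^ 2)) := by gcongr
    linarith
  linarith

theorem quartic_le (hp : 1 ≤ p) {q : ℕ}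
    (h : IsProfile p u a w w₁ w₂ v) (hc : IsCutoff δ χ χ₁ χ₂) :
    ∫ x, χ x ^ (8 * q + 6) * (u x * w x ^ 4) ≤
      18 * (∫ x, χ x ^ (8 * q + 6) * (u x * (a x * w₁ x) ^ 2))
        + 2 * (8 * q + 6) ^ 2 * δ ^ 2 * ∫ x, χ x ^ (8 * q + 4) * (u x * (a x * w x) ^ 2) := by
  have cu := h.continuous_u
  have ca := h.continuous_a
  have cw := h.continuous_w
  have cw₁ := h.continuous_w₁
  have cχ := hc.continuous
  have cχ₁ := hc.continuous₁
  have hd : ∀ x, HasDerivAt (fun y => 2 * (χ y ^ (8 * q + 5 + 1) * (w y ^ 3 * (u y * a y))))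
      (2 * ((8 * q + 5 + 1 : ℝ) * (χ x ^ (8 * q + 5) * χ₁ x) * (w x ^ 3 * (u x * a x))
        + χ x ^ (8 * q + 5 + 1) * (3 * w x ^ 2 * w₁ x * (u x * a x)
          + w x ^ 3 * (p * (u x * w x))))) x := fun x => by
    have := ((hc.hasDerivAt_pow (8 * q + 5) x).mul
      (((h.hasDerivAt_w x).pow 3).mul (h.hasDerivAt_ua x))).const_mul 2
    push_cast at this
    exact this
  have hI : Integrable fun x => χ x ^ (8 * q + 6) * (u x * w x ^ 4) :=
    hc.integrable (by fun_prop) fun x hx => by simp [hx]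
  have hI1 : Integrable fun x => χ x ^ (8 * q + 6) * (u x * (a x * w₁ x) ^ 2) :=
    hc.integrable (by fun_prop) fun x hx => by simp [hx]
  have hI2 : Integrable fun x => χ x ^ (8 * q + 4) * (u x * (a x * w x) ^ 2) :=
    hc.integrable (by fun_prop) fun x hx => by simp [hx]
  have key := hc.integral_le_of_le_deriv_add (c₁ := 18)
    (c₂ := 2 * (8 * q + 6) ^ 2 * δ ^ 2) (c₃ := 0)
    hd (by fun_prop) (fun x hx => by simp [hx]) (fun x hx => by simp [hx]) hI hI1 hI2 hI2
    fun x => ?_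
  · linarith
  have hu := h.pos x
  have ha := h.a_pos x
  have hχ := hc.nonneg x
  have hδx := sq_le_sq' (abs_le.1 (hc.abs_le₁ x)).1 (abs_le.1 (hc.abs_le₁ x)).2
  generalize u x = U at *
  generalize a x = A at *
  generalize w x = ω at *
  generalize w₁ x = ω₁ at *
  generalize χ₁ x = d at *
  generalize χ x = c at *
  have he : 0 ≤ c ^ (8 * q) := by positivity
  rw [show c ^ (8 * q + 4) = c ^ (8 * q) * c ^ 4 by ring,
    show c ^ (8 * q + 6) = c ^ (8 * q) * c ^ 6 by ring,
    show c ^ (8 * q + 5) = c ^ (8 * q) * c ^ 5 by ring]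
  generalize c ^ (8 * q) = e at *
  have t1 : -6 * (e * c ^ 6 * (ω ^ 2 * ω₁ * (U * A))) ≤
      1 / 2 * (e * c ^ 6 * (U * ω ^ 4)) + 18 * (e * c ^ 6 * (U * (A * ω₁) ^ 2)) := by
    have : 0 ≤ 1 / 2 * e * c ^ 6 * U * (ω ^ 2 + 6 * (A * ω₁)) ^ 2 := by positivity
    linarith
  have t2 : -2 * ((8 * q + 6 : ℝ) * (e * c ^ 5 * d) * (ω ^ 3 * (U * A))) ≤
      1 / 2 * (e * c ^ 6 * (U * ω ^ 4))
        + 2 * (8 * q + 6) ^ 2 * δ ^ 2 * (e * c ^ 4 * (U * (A * ω) ^ 2)) := by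
    have i1 : -2 * ((8 * q + 6 : ℝ) * (e * c ^ 5 * d) * (ω ^ 3 * (U * A))) ≤
        1 / 2 * (e * c ^ 6 * (U * ω ^ 4))
        + 2 * (8 * q + 6) ^ 2 * d ^ 2 * (e * c ^ 4 * (U * (A * ω) ^ 2)) := by
      have : 0 ≤ 1 / 2 * e * c ^ 4 * U * (c * ω ^ 2 + 2 * (8 * q + 6 : ℝ) * d * A * ω) ^ 2 := by
        positivity
      linarith
    have i2 : 2 * (8 * q + 6 : ℝ) ^ 2 * d ^ 2 * (e * c ^ 4 * (U * (A * ω) ^ 2)) ≤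
        2 * (8 * q + 6 : ℝ) ^ 2 * δ ^ 2 * (e * c ^ 4 * (U * (A * ω) ^ 2)) := by gcongr
    linarith
  have t3 : e * c ^ 6 * (U * ω ^ 4) ≤ p * (e * c ^ 6 * (U * ω ^ 4)) :=
    le_mul_of_one_le_left (by positivity) hp
  linarith

theorem energy_rate_le_absorbable (hp : 1 ≤ p) {q : ℕ}
    (h : IsProfile p u a w w₁ w₂ v) (hc : IsCutoff δ χ χ₁ χ₂) (hδ : δ ≤ 1) :
    ∫ x, -(u x * (a x * w₂ x + p * (w x * w₁ x)))
        * (χ x ^ (8 * q + 8) * (a x * w₂ x + p * (w x * w₁ x))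
          + (8 * q + 8) * (χ x ^ (8 * q + 7) * χ₁ x)
            * (2 * (a x * w₁ x) + (p - 1 / 2) * w x ^ 2)
          + (8 * q + 8) * ((8 * q + 7) * (χ x ^ (8 * q + 6) * χ₁ x) * χ₁ x
            + χ x ^ (8 * q + 7) * χ₂ x) * (a x * w x)) ≤
      -(1 / 2) * (∫ x, χ x ^ (8 * q + 8) * (u x * (a x * w₂ x + p * (w x * w₁ x)) ^ 2))
        + (8 + 36 * p ^ 2) * (8 * q + 8) ^ 4 * δ ^ 2
          * ((∫ x, χ x ^ (8 * q + 6) * (u x * (a x * w₁ x) ^ 2))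
            + ∫ x, χ x ^ (8 * q + 4) * (u x * (a x * w x) ^ 2)) := by
  have hδ0 : 0 ≤ δ := (abs_nonneg _).trans (hc.abs_le₁ 0)
  have cu := h.continuous_u
  have ca := h.continuous_a
  have cw := h.continuous_w
  have cw₁ := h.continuous_w₁
  have cw₂ := h.continuous_w₂
  have cχ := hc.continuous
  have cχ₁ := hc.continuous₁
  have cχ₂ := hc.continuous₂
  have hI : Integrable fun x => χ x ^ (8 * q + 6) * (u x * w x ^ 4) :=
    hc.integrable (by fun_prop) fun x hx => by simp [hx]
  have hI1 : Integrable fun x => χ x ^ (8 * q + 6) * (u x * (a x * w₁ x) ^ 2) :=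
    hc.integrable (by fun_prop) fun x hx => by simp [hx]
  have hI2 : Integrable fun x => χ x ^ (8 * q + 4) * (u x * (a x * w x) ^ 2) :=
    hc.integrable (by fun_prop) fun x hx => by simp [hx]
  have hI3 : Integrable fun x =>
      χ x ^ (8 * q + 8) * (u x * (a x * w₂ x + p * (w x * w₁ x)) ^ 2) :=
    hc.integrable (by fun_prop) fun x hx => by simp [hx]
  have hF := quartic_le (q := q) hp h hc
  have hIs : Integrable fun x => 8 * (8 * q + 8 : ℝ) ^ 2 * δ ^ 2
      * (χ x ^ (8 * q + 6) * (u x * (a x * w₁ x) ^ 2))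
      + 4 * (8 * q + 8) ^ 4 * δ ^ 2 * (χ x ^ (8 * q + 4) * (u x * (a x * w x) ^ 2)) :=
    (hI1.const_mul _).add (hI2.const_mul _)
  have key := hc.integral_le_of_le_deriv_add (g := fun _ => 0) (g' := fun _ => 0)
    (c₁ := -(1 / 2)) (c₂ := 1) (c₃ := 2 * p ^ 2 * (8 * q + 8) ^ 2 * δ ^ 2)
    (f := fun x => -(u x * (a x * w₂ x + p * (w x * w₁ x)))
        * (χ x ^ (8 * q + 8) * (a x * w₂ x + p * (w x * w₁ x))
          + (8 * q + 8) * (χ x ^ (8 * q + 7) * χ₁ x)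
            * (2 * (a x * w₁ x) + (p - 1 / 2) * w x ^ 2)
          + (8 * q + 8) * ((8 * q + 7) * (χ x ^ (8 * q + 6) * χ₁ x) * χ₁ x
            + χ x ^ (8 * q + 7) * χ₂ x) * (a x * w x)))
    (fun x => hasDerivAt_const x 0) continuous_const (fun _ _ => rfl) (fun _ _ => rfl)
    (hc.integrable (by fun_prop) fun x hx => by simp [hx]) hI3 hIs hI fun x => ?_
  · rw [integral_add (hI1.const_mul _) (hI2.const_mul _), integral_const_mul,
      integral_const_mul] at key
    have hP : 0 ≤ ∫ x, χ x ^ (8 * q + 6) * (u x * (a x * w₁ x) ^ 2) := integral_nonneg fun x => by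
      have := h.pos x; have := hc.nonneg x; positivity
    have hQ : 0 ≤ ∫ x, χ x ^ (8 * q + 4) * (u x * (a x * w x) ^ 2) := integral_nonneg fun x => by
      have := h.pos x; have := hc.nonneg x; positivity
    generalize ∫ x, χ x ^ (8 * q + 6) * (u x * (a x * w₁ x) ^ 2) = P at *
    generalize ∫ x, χ x ^ (8 * q + 4) * (u x * (a x * w x) ^ 2) = Q at *
    have hn : (1:ℝ) ≤ 8 * q + 8 := by
      have : (0:ℝ) ≤ q := by positivity
      linarith
    have hq0 : (0:ℝ) ≤ q := by positivity
    have hn24 : (8 * q + 8 : ℝ) ^ 2 ≤ (8 * q + 8) ^ 4 := pow_le_pow_right₀ hn (by norm_num)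
    have hδ2 : δ ^ 2 ≤ 1 := pow_le_one₀ hδ0 hδ
    refine key.trans ?_
    have k1 : 2 * p ^ 2 * (8 * q + 8) ^ 2 * δ ^ 2
          * ∫ x, χ x ^ (8 * q + 6) * (u x * w x ^ 4)
        ≤ 2 * p ^ 2 * (8 * q + 8) ^ 2 * δ ^ 2
          * (18 * P + 2 * (8 * q + 6) ^ 2 * δ ^ 2 * Q) := by gcongr
    have k2 : 8 * (8 * q + 8) ^ 2 * δ ^ 2 * P ≤ 8 * (8 * q + 8) ^ 4 * δ ^ 2 * P := by gcongr
    have k3 : 36 * p ^ 2 * ((8 * q + 8) ^ 2 * δ ^ 2 * P)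
      ≤ 36 * p ^ 2 * ((8 * q + 8) ^ 4 * δ ^ 2 * P) := by gcongr
    have k4 : 4 * p ^ 2 * (8 * q + 8) ^ 2 * δ ^ 2 * ((8 * q + 6) ^ 2 * δ ^ 2 * Q)
      ≤ 4 * p ^ 2 * (8 * q + 8) ^ 2 * δ ^ 2 * ((8 * q + 8) ^ 2 * 1 * Q) := by
        gcongr
        norm_num
    have k5 : 0 ≤ 4 * (8 * q + 8) ^ 4 * δ ^ 2 * Q := by positivity
    have k6 : 0 ≤ 32 * p ^ 2 * (8 * q + 8) ^ 4 * δ ^ 2 * Q := by positivity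
    linarith
  have hu := h.pos x
  have hχ := hc.nonneg x
  have hχ1 := hc.le_one x
  have hδx := sq_le_sq' (abs_le.1 (hc.abs_le₁ x)).1 (abs_le.1 (hc.abs_le₁ x)).2
  have hδx₂ := sq_le_sq' (abs_le.1 (hc.abs_le₂ x)).1 (abs_le.1 (hc.abs_le₂ x)).2
  generalize a x * w₂ x + p * (w x * w₁ x) = r at *
  rw [show (u x * w x ^ 4) = u x * (w x ^ 2) ^ 2 by ring]
  generalize a x * w₁ x = A at *
  generalize a x * w x = b at *
  generalize w x ^ 2 = B at *
  generalize u x = U at *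
  generalize χ₁ x = d at *
  generalize χ₂ x = d₂ at *
  generalize χ x = c at *
  have he : 0 ≤ c ^ (8 * q) := by positivity
  rw [show c ^ (8 * q + 4) = c ^ (8 * q) * c ^ 4 by ring,
    show c ^ (8 * q + 6) = c ^ (8 * q) * c ^ 6 by ring,
    show c ^ (8 * q + 7) = c ^ (8 * q) * c ^ 7 by ring,
    show c ^ (8 * q + 8) = c ^ (8 * q) * c ^ 8 by ring]
  generalize c ^ (8 * q) = e at *
  have hq0 : (0:ℝ) ≤ q := by positivity
  have hn1 : (8 * q + 7 : ℝ) ≤ 8 * q + 8 := by linarith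
  have hn0 : (1 : ℝ) ≤ 8 * q + 8 := by linarith
  have hn7 : (0 : ℝ) ≤ 8 * q + 7 := by linarith
  generalize (8 * q + 7 : ℝ) = m at *
  generalize (8 * q + 8 : ℝ) = n at *
  have hδ2 : δ ^ 2 ≤ 1 := pow_le_one₀ hδ0 hδ
  have hc2 : c ^ 2 ≤ 1 := pow_le_one₀ hχ hχ1
  have t1 : -(U * r) * (n * (e * c ^ 7 * d) * (2 * A)) ≤
      1 / 8 * (e * c ^ 8 * (U * r ^ 2)) + 8 * n ^ 2 * δ ^ 2 * (e * c ^ 6 * (U * A ^ 2)) := by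
    have i0 : 0 ≤ 1 / 8 * (e * c ^ 6 * U) * (c * r + 8 * n * d * A) ^ 2 := by positivity
    have i1 : 8 * n ^ 2 * d ^ 2 * (e * c ^ 6 * (U * A ^ 2))
      ≤ 8 * n ^ 2 * δ ^ 2 * (e * c ^ 6 * (U * A ^ 2)) := by gcongr
    linarith
  have t2 : -(U * r) * (n * (e * c ^ 7 * d) * ((p - 1 / 2) * B)) ≤
      1 / 8 * (e * c ^ 8 * (U * r ^ 2)) + 2 * p ^ 2 * n ^ 2 * δ ^ 2 * (e * c ^ 6 * (U * B ^ 2)) := by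
    have i0 : 0 ≤ 1 / 8 * (e * c ^ 6 * U) * (c * r + 4 * (p - 1 / 2) * n * d * B) ^ 2 := by
      positivity
    have hp2 : (p - 1 / 2) ^ 2 ≤ p ^ 2 := by gcongr <;> linarith
    have i1 : 2 * (p - 1 / 2) ^ 2 * n ^ 2 * d ^ 2 * (e * c ^ 6 * (U * B ^ 2))
      ≤ 2 * p ^ 2 * n ^ 2 * δ ^ 2 * (e * c ^ 6 * (U * B ^ 2)) := by gcongr
    linarith
  have t3 : -(U * r) * (n * (m * (e * c ^ 6 * d) * d) * b) ≤
      1 / 8 * (e * c ^ 8 * (U * r ^ 2)) + 2 * n ^ 4 * δ ^ 2 * (e * c ^ 4 * (U * b ^ 2)) := by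
    have i0 : 0 ≤ 1 / 8 * (e * c ^ 4 * U) * (c ^ 2 * r + 4 * n * m * d ^ 2 * b) ^ 2 := by
      positivity
    have i1 : 2 * n ^ 2 * m ^ 2 * (d ^ 2 * d ^ 2) * (e * c ^ 4 * (U * b ^ 2))
      ≤ 2 * n ^ 2 * n ^ 2 * (1 * δ ^ 2) * (e * c ^ 4 * (U * b ^ 2)) := by
        gcongr
        exact hδx.trans hδ2
    linarith
  have t4 : -(U * r) * (n * (e * c ^ 7 * d₂) * b) ≤
      1 / 8 * (e * c ^ 8 * (U * r ^ 2)) + 2 * n ^ 4 * δ ^ 2 * (e * c ^ 4 * (U * b ^ 2)) := by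
    have i0 : 0 ≤ 1 / 8 * (e * c ^ 6 * U) * (c * r + 4 * n * d₂ * b) ^ 2 := by
      positivity
    have i1 : 2 * n ^ 2 * d₂ ^ 2 * (e * c ^ 4 * c ^ 2 * (U * b ^ 2))
      ≤ 2 * n ^ 4 * δ ^ 2 * (e * c ^ 4 * 1 * (U * b ^ 2)) := by
        gcongr
        norm_num
    linarith
  linarith

theorem IsProfile.hasDerivAt_pressure (h : IsProfile p u a w w₁ w₂ v) (x : ℝ) :
    HasDerivAt (fun y => u y * a y * w₁ y) (u x * (a x * w₂ x + p * (w x * w₁ x))) x := by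
  have := (h.hasDerivAt_ua x).mul (h.hasDerivAt_w₁ x)
  refine this.congr_deriv ?_
  ring

set_option maxHeartbeats 1000000 in
/-- The localized Fisher information grows at rate `O(δ ^ 2)`, uniformly in the profile. -/
theorem energy_rate_le (hp : 1 ≤ p) {q : ℕ} (hq : p - 1 ≤ q) : ∃ K δ₀ : ℝ, 0 < K ∧ 0 < δ₀ ∧
    ∀ (δ : ℝ) (u a w w₁ w₂ v χ χ₁ χ₂ : ℝ → ℝ), IsProfile p u a w w₁ w₂ v → IsCutoff δ χ χ₁ χ₂ →
      δ ≤ δ₀ →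
      ∫ x, -(u x * (a x * w₂ x + p * (w x * w₁ x)))
        * (χ x ^ (8 * q + 8) * (a x * w₂ x + p * (w x * w₁ x))
          + (8 * q + 8) * (χ x ^ (8 * q + 7) * χ₁ x)
            * (2 * (a x * w₁ x) + (p - 1 / 2) * w x ^ 2)
          + (8 * q + 8) * ((8 * q + 7) * (χ x ^ (8 * q + 6) * χ₁ x) * χ₁ x
            + χ x ^ (8 * q + 7) * χ₂ x) * (a x * w x)) ≤ K * δ ^ 2 := by
  have hq0 : (0:ℝ) ≤ q := by positivity
  obtain ⟨C, δ₁, hC, hδ₁, hab⟩ := absorption (K := (6 * q + 6) ^ 2 * (2 + 2 * p) ^ 2) (by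
    have : (1:ℝ) ≤ 6 * q + 6 := by linarith
    have : (1:ℝ) ≤ 2 + 2 * p := by linarith
    exact one_le_mul_of_one_le_of_one_le (one_le_pow₀ ‹_›) (one_le_pow₀ ‹_›))
  set K := (8 + 36 * p ^ 2) * (8 * q + 8 : ℝ) ^ 4 * (2 * (2 + 2 * p) ^ 2 * C) with hK
  have hK0 : 0 < K := by positivity
  refine ⟨K, min (min 1 δ₁) (min (1 / (4 * q + 4)) (1 / (2 * K + 1))), hK0, by positivity, ?_⟩
  intro δ u a w w₁ w₂ v χ χ₁ χ₂ h hc hδ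
  have hδ0 : 0 ≤ δ := (abs_nonneg _).trans (hc.abs_le₁ 0)
  have hd1 : δ ≤ 1 := hδ.trans ((min_le_left _ _).trans (min_le_left _ _))
  have hd2 : δ ≤ δ₁ := hδ.trans ((min_le_left _ _).trans (min_le_right _ _))
  have hd3 : (2 * q + 2) * δ ≤ 1 / 2 := by
    have : δ ≤ 1 / (4 * q + 4) := hδ.trans ((min_le_right _ _).trans (min_le_left _ _))
    rw [le_div_iff₀ (by positivity)] at this
    linarith
  have hd4 : K * δ ^ 2 ≤ 1 / 2 := by
    have : δ ≤ 1 / (2 * K + 1) := hδ.trans ((min_le_right _ _).trans (min_le_right _ _))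
    rw [le_div_iff₀ (by positivity)] at this
    have i : δ * δ ≤ δ * 1 := by gcongr
    have i' : K * (δ * δ) ≤ K * (δ * 1) := by gcongr
    linarith
  have cu := h.continuous_u
  have ca := h.continuous_a
  have cw := h.continuous_w
  have cw₁ := h.continuous_w₁
  have cχ := hc.continuous
  refine (energy_rate_le_absorbable (q := q) hp h hc hd1).trans ?_
  set W := ∫ x, χ x ^ (4 * q + 4) * (u x * w x ^ 2) with hWdef
  have hW0 : 0 ≤ W := integral_nonneg fun x => by
    have := h.pos x; have := hc.nonneg x; positivity
  set G := ∫ x, χ x ^ (6 * q + 6) * (u x * (a x * w₁ x ^ 2)) with hGdef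
  have hG0 : 0 ≤ G := integral_nonneg fun x => by
    have := h.pos x; have := h.a_pos x; have := hc.nonneg x; positivity
  set D := ∫ x, χ x ^ (8 * q + 8) * (u x * (a x * w₂ x + p * (w x * w₁ x)) ^ 2) with hDdef
  have hD0 : 0 ≤ D := integral_nonneg fun x => by
    have := h.pos x; have := hc.nonneg x; positivity
  set τ := 1 + √W with hτ
  have hs0 : 0 ≤ √W := Real.sqrt_nonneg W
  have hs : √W ^ 2 = W := Real.sq_sqrt hW0
  have hτ1 : 1 ≤ τ := by linarith
  have hWτ : W ≤ τ ^ 2 := by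
    have : τ ^ 2 = 1 + 2 * √W + √W ^ 2 := by rw [hτ]; ring
    linarith
  have hτW : τ ^ 2 ≤ 2 + 2 * W := by
    have : τ ^ 2 = 1 + 2 * √W + √W ^ 2 := by rw [hτ]; ring
    linarith [sq_nonneg (√W - 1)]
  have hS := weighted_sup_le hp hq h hc hd3 hτ1 hWτ
  have hS0 : 0 ≤ (2 + 2 * p) * τ := by positivity
  have hp2 : 2 + 2 * p ≤ (2 + 2 * p) ^ 2 := le_self_pow₀ (by linarith) two_ne_zero
  have hq2 : (4 * q + 4 : ℝ) ^ 2 ≤ (6 * q + 6) ^ 2 := by gcongr <;> norm_num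
  have hq6 : (36:ℝ) ≤ (6 * q + 6) ^ 2 := by
    calc (36:ℝ) = 6 ^ 2 := by norm_num
      _ ≤ _ := by gcongr; linarith
  have hp16 : (16:ℝ) ≤ (2 + 2 * p) ^ 2 := by
    calc (16:ℝ) = 4 ^ 2 := by norm_num
      _ ≤ _ := by gcongr; linarith
  have hKp : (2 + 2 * p) ^ 2 ≤ (6 * q + 6 : ℝ) ^ 2 * (2 + 2 * p) ^ 2 :=
    le_mul_of_one_le_left (by positivity) (by linarith)
  have hab' := hab D G W τ δ hD0 hG0 hW0 hδ0 hd2 hτ1 hWτ hτW ?_ ?_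
  · have hP : ∫ x, χ x ^ (8 * q + 6) * (u x * (a x * w₁ x) ^ 2) ≤ (2 + 2 * p) * τ * G := by
      rw [hGdef, ← integral_const_mul]
      refine integral_mono (hc.integrable (by fun_prop) fun x hx => by simp [hx])
        ((hc.integrable (by fun_prop) fun x hx => by simp [hx]).const_mul _) fun x => ?_
      have := h.pos x
      have := h.a_pos x
      have := hc.nonneg x
      calc χ x ^ (8 * q + 6) * (u x * (a x * w₁ x) ^ 2)
          = (χ x ^ (2 * q) * a x) * (χ x ^ (6 * q + 6) * (u x * (a x * w₁ x ^ 2))) := by ring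
        _ ≤ (2 + 2 * p) * τ * (χ x ^ (6 * q + 6) * (u x * (a x * w₁ x ^ 2))) := by
          exact mul_le_mul_of_nonneg_right (hS x) (by positivity)
    have hQ : ∫ x, χ x ^ (8 * q + 4) * (u x * (a x * w x) ^ 2) ≤ ((2 + 2 * p) * τ) ^ 2 * W := by
      rw [hWdef, ← integral_const_mul]
      refine integral_mono (hc.integrable (by fun_prop) fun x hx => by simp [hx])
        ((hc.integrable (by fun_prop) fun x hx => by simp [hx]).const_mul _) fun x => ?_
      have := h.pos x
      have := h.a_pos x
      have := hc.nonneg x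
      calc χ x ^ (8 * q + 4) * (u x * (a x * w x) ^ 2)
          = (χ x ^ (2 * q) * a x) ^ 2 * (χ x ^ (4 * q + 4) * (u x * w x ^ 2)) := by ring
        _ ≤ ((2 + 2 * p) * τ) ^ 2 * (χ x ^ (4 * q + 4) * (u x * w x ^ 2)) := by
          exact mul_le_mul_of_nonneg_right
            (pow_le_pow_left₀ (by positivity) (hS x) 2) (by positivity)
    have hsum : (2 + 2 * p) * τ * G + ((2 + 2 * p) * τ) ^ 2 * W
        ≤ 2 * (2 + 2 * p) ^ 2 * C * (1 + D) := by
      have i1 : (2 + 2 * p) * (τ * G) ≤ (2 + 2 * p) ^ 2 * (C * (1 + D)) := by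
        exact mul_le_mul hp2 hab'.1 (by positivity) (by positivity)
      have i2 : (2 + 2 * p) ^ 2 * (τ ^ 2 * W) ≤ (2 + 2 * p) ^ 2 * (C * (1 + D)) := by
        exact mul_le_mul_of_nonneg_left hab'.2 (by positivity)
      linarith
    have i3 : (8 + 36 * p ^ 2) * (8 * q + 8) ^ 4 * δ ^ 2
          * ((∫ x, χ x ^ (8 * q + 6) * (u x * (a x * w₁ x) ^ 2))
            + ∫ x, χ x ^ (8 * q + 4) * (u x * (a x * w x) ^ 2))
        ≤ (8 + 36 * p ^ 2) * (8 * q + 8) ^ 4 * δ ^ 2 * (2 * (2 + 2 * p) ^ 2 * C * (1 + D)) := by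
      gcongr
      linarith
    have i4 : (8 + 36 * p ^ 2) * (8 * q + 8) ^ 4 * δ ^ 2 * (2 * (2 + 2 * p) ^ 2 * C * (1 + D))
        = K * δ ^ 2 + K * δ ^ 2 * D := by rw [hK]; ring
    have i5 : K * δ ^ 2 * D ≤ 1 / 2 * D := by gcongr
    linarith
  · intro μ hμ
    have := fisher_le (q := q) hp h hc hS hμ
    refine this.trans ?_
    have j1 : 2 * (μ * G) ≤ (6 * q + 6) ^ 2 * (2 + 2 * p) ^ 2 * (μ * G) := by
      gcongr
      linarith
    have j2 : (1 + p) * (τ / μ) ≤ (6 * q + 6) ^ 2 * (2 + 2 * p) ^ 2 * (τ / μ) := by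
      gcongr
      linarith
    have j3 : (4 * q + 4) ^ 2 * ((2 + 2 * p) ^ 2 * (δ ^ 2 * τ ^ 2))
      ≤ (6 * q + 6) ^ 2 * ((2 + 2 * p) ^ 2 * (δ ^ 2 * τ ^ 2)) := by gcongr
    have e : (2 + 2 * p) * τ / (2 * μ) = (1 + p) * (τ / μ) := by field_simp
    rw [e]
    linarith
  · intro μ hμ
    have := curvature_le (q := q) h hc hS hμ h.hasDerivAt_pressure
    refine this.trans ?_
    have j1 : 2 * (μ * D) ≤ (6 * q + 6) ^ 2 * (2 + 2 * p) ^ 2 * (μ * D) := by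
      gcongr
      linarith
    have j2 : 1 / 2 * (W / μ) ≤ (6 * q + 6) ^ 2 * (2 + 2 * p) ^ 2 * (W / μ) := by
      gcongr
      linarith
    have j3 : (6 * q + 6) ^ 2 * δ ^ 2 * ((2 + 2 * p) * τ) * W
      ≤ (6 * q + 6) ^ 2 * δ ^ 2 * ((2 + 2 * p) ^ 2 * τ) * τ ^ 2 := by gcongr
    have e : 1 / (2 * μ) * W = 1 / 2 * (W / μ) := by field_simp
    rw [← hDdef, ← hWdef, add_mul, e]
    linarith

end FixedTime

section SpaceTime

/-- Partial derivative in the first variable. -/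
noncomputable def dX (F : ℝ × ℝ → ℝ) (z : ℝ × ℝ) : ℝ := fderiv ℝ F z (1, 0)

/-- Partial derivative in the second variable. -/
noncomputable def dT (F : ℝ × ℝ → ℝ) (z : ℝ × ℝ) : ℝ := fderiv ℝ F z (0, 1)

variable {T : ℝ} {F : ℝ × ℝ → ℝ}

theorem isOpen_strip : IsOpen ((univ : Set ℝ) ×ˢ Ioo 0 T) := isOpen_univ.prod isOpen_Ioo

theorem contDiffOn_dX (hF : ContDiffOn ℝ (⊤ : ℕ∞) F (univ ×ˢ Ioo 0 T)) :
    ContDiffOn ℝ (⊤ : ℕ∞) (dX F) (univ ×ˢ Ioo 0 T) :=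
  (hF.fderiv_of_isOpen isOpen_strip (by simp)).clm_apply contDiffOn_const

theorem contDiffOn_dT (hF : ContDiffOn ℝ (⊤ : ℕ∞) F (univ ×ˢ Ioo 0 T)) :
    ContDiffOn ℝ (⊤ : ℕ∞) (dT F) (univ ×ˢ Ioo 0 T) :=
  (hF.fderiv_of_isOpen isOpen_strip (by simp)).clm_apply contDiffOn_const

theorem contDiffAt_strip (hF : ContDiffOn ℝ (⊤ : ℕ∞) F (univ ×ˢ Ioo 0 T)) {t : ℝ}
    (ht : t ∈ Ioo 0 T) (x : ℝ) : ContDiffAt ℝ (⊤ : ℕ∞) F (x, t) :=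
  hF.contDiffAt (isOpen_strip.mem_nhds ⟨mem_univ _, ht⟩)

theorem hasFDerivAt_strip (hF : ContDiffOn ℝ (⊤ : ℕ∞) F (univ ×ˢ Ioo 0 T)) {t : ℝ}
    (ht : t ∈ Ioo 0 T) (x : ℝ) : HasFDerivAt F (fderiv ℝ F (x, t)) (x, t) :=
  ((contDiffAt_strip hF ht x).differentiableAt (by simp)).hasFDerivAt

theorem hasDerivAt_dX (hF : ContDiffOn ℝ (⊤ : ℕ∞) F (univ ×ˢ Ioo 0 T)) {t : ℝ}
    (ht : t ∈ Ioo 0 T) (x : ℝ) : HasDerivAt (fun y => F (y, t)) (dX F (x, t)) x :=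
  (hasFDerivAt_strip hF ht x).comp_hasDerivAt x ((hasDerivAt_id x).prodMk (hasDerivAt_const x t))

theorem hasDerivAt_dT (hF : ContDiffOn ℝ (⊤ : ℕ∞) F (univ ×ˢ Ioo 0 T)) {t : ℝ}
    (ht : t ∈ Ioo 0 T) (x : ℝ) : HasDerivAt (fun s => F (x, s)) (dT F (x, t)) t :=
  (hasFDerivAt_strip hF ht x).comp_hasDerivAt t ((hasDerivAt_const t x).prodMk (hasDerivAt_id t))

theorem dT_dX (hF : ContDiffOn ℝ (⊤ : ℕ∞) F (univ ×ˢ Ioo 0 T)) {t : ℝ}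
    (ht : t ∈ Ioo 0 T) (x : ℝ) : dT (dX F) (x, t) = dX (dT F) (x, t) := by
  have hd : DifferentiableAt ℝ (fderiv ℝ F) (x, t) :=
    ((contDiffAt_strip hF ht x).fderiv_right (m := 1)
      (show ((2 : ℕ∞) : WithTop ℕ∞) ≤ _ from WithTop.coe_le_coe.2 le_top)).differentiableAt (by simp)
  have hs : IsSymmSndFDerivAt ℝ F (x, t) :=
    (contDiffAt_strip hF ht x).isSymmSndFDerivAt (by
      rw [minSmoothness_of_isRCLikeNormedField]
      exact (show ((2 : ℕ∞) : WithTop ℕ∞) ≤ _ from WithTop.coe_le_coe.2 le_top))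
  have e1 : dT (dX F) (x, t) = fderiv ℝ (fderiv ℝ F) (x, t) (0, 1) (1, 0) := by
    have := hd.hasFDerivAt.clm_apply (hasFDerivAt_const ((1, 0) : ℝ × ℝ) (x, t))
    have e : fderiv ℝ (dX F) (x, t) = _ := this.fderiv
    rw [dT, e]
    simp
  have e2 : dX (dT F) (x, t) = fderiv ℝ (fderiv ℝ F) (x, t) (1, 0) (0, 1) := by
    have := hd.hasFDerivAt.clm_apply (hasFDerivAt_const ((0, 1) : ℝ × ℝ) (x, t))
    have e : fderiv ℝ (dT F) (x, t) = _ := this.fderiv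
    rw [dX, e]
    simp
  rw [e1, e2]
  exact hs _ _

theorem continuous_slice (hF : ContDiffOn ℝ (⊤ : ℕ∞) F (univ ×ˢ Ioo 0 T)) {t : ℝ}
    (ht : t ∈ Ioo 0 T) : Continuous fun x => F (x, t) :=
  continuous_iff_continuousAt.2 fun x => (hasDerivAt_dX hF ht x).continuousAt

end SpaceTime

theorem hasDerivAt_lnp (p : ℝ) {y : ℝ} (hy : 0 < y) : HasDerivAt (lnp p) (y ^ (p - 2)) y := by
  by_cases hp : p = 1
  · have e : lnp p = Real.log := funext fun z => by simp [lnp, hp]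
    rw [e, hp, show (1:ℝ) - 2 = -1 by norm_num, Real.rpow_neg_one]
    exact Real.hasDerivAt_log hy.ne'
  · have e : lnp p = fun z => (z ^ (p - 1) - 1) / (p - 1) := funext fun z => by simp [lnp, hp]
    have hp' : p - 1 ≠ 0 := sub_ne_zero.2 hp
    rw [e]
    have := ((Real.hasDerivAt_rpow_const (p := p - 1) (Or.inl hy.ne')).sub_const 1).div_const (p - 1)
    refine this.congr_deriv ?_
    rw [mul_div_cancel_left₀ _ hp']
    congr 1
    ring

theorem contDiffOn_lnp (p : ℝ) : ContDiffOn ℝ (⊤ : ℕ∞) (lnp p) (Ioi 0) := by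
  by_cases hp : p = 1
  · have e : lnp p = Real.log := funext fun z => by simp [lnp, hp]
    rw [e]
    exact fun z hz => (Real.contDiffAt_log.2 (ne_of_gt hz)).contDiffWithinAt
  · have e : lnp p = fun z => (z ^ (p - 1) - 1) / (p - 1) := funext fun z => by simp [lnp, hp]
    rw [e]
    exact ((contDiffOn_id.rpow_const_of_ne fun z hz => ne_of_gt hz).sub contDiffOn_const).div_const _

/-- A smooth positive solution of `∂ₜ u = -v`, `v = (u ^ p w₁)''`, where each `(u t, …)` is a
profile and `wt` is the time derivative of `w`. -/
structure IsFlow (p T : ℝ) (u a w w₁ w₂ v wt : ℝ → ℝ → ℝ) : Prop where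
  profile : ∀ t ∈ Ioo 0 T, IsProfile p (u t) (a t) (w t) (w₁ t) (w₂ t) (v t)
  hasDerivAt_u : ∀ t ∈ Ioo 0 T, ∀ x, HasDerivAt (fun s => u s x) (-v t x) t
  hasDerivAt_w : ∀ t ∈ Ioo 0 T, ∀ x, HasDerivAt (fun s => w s x) (wt t x) t
  hasDerivAt_rate : ∀ t ∈ Ioo 0 T, ∀ x,
    HasDerivAt (fun y => -(a t y * v t y / u t y)) (wt t x) x
  continuousOn_u : ContinuousOn (fun z : ℝ × ℝ => u z.2 z.1) (univ ×ˢ Ioo 0 T)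
  continuousOn_w : ContinuousOn (fun z : ℝ × ℝ => w z.2 z.1) (univ ×ˢ Ioo 0 T)
  continuousOn_v : ContinuousOn (fun z : ℝ × ℝ => v z.2 z.1) (univ ×ˢ Ioo 0 T)
  continuousOn_wt : ContinuousOn (fun z : ℝ × ℝ => wt z.2 z.1) (univ ×ˢ Ioo 0 T)

theorem exists_isFlow {p T : ℝ} {u : ℝ → ℝ → ℝ}
    (hsmooth : ContDiffOn ℝ (⊤ : ℕ∞) (Function.uncurry u) (univ ×ˢ Ioo 0 T))
    (hpos : ∀ x t, t ∈ Ioo 0 T → 0 < u x t)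
    (hpde : ∀ x t, t ∈ Ioo 0 T →
      deriv (fun s => u x s) t =
        - deriv (deriv (fun z =>
            (u z t) ^ p * deriv (deriv (fun w => lnp p (u w t))) z)) x)
    (hdens : ∀ t ∈ Ioo 0 T, Integrable (fun x => u x t) ∧ (∫ x : ℝ, u x t) = 1) :
    ∃ a w w₁ w₂ v wt : ℝ → ℝ → ℝ, IsFlow p T (fun t x => u x t) a w w₁ w₂ v wt ∧
      ∀ t ∈ Ioo 0 T, ∀ x, deriv (fun z => lnp p (u z t)) x = w t x := by
  set U := Function.uncurry u with hU
  have hUpos : ∀ z ∈ (univ : Set ℝ) ×ˢ Ioo 0 T, 0 < U z := fun z hz => hpos z.1 z.2 hz.2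
  have hL : ContDiffOn ℝ (⊤ : ℕ∞) (fun z => lnp p (U z)) (univ ×ˢ Ioo 0 T) :=
    (contDiffOn_lnp p).comp hsmooth hUpos
  have ha : ContDiffOn ℝ (⊤ : ℕ∞) (fun z => U z ^ (p - 1)) (univ ×ˢ Ioo 0 T) :=
    hsmooth.rpow_const_of_ne fun z hz => (hUpos z hz).ne'
  set A := fun z => U z ^ (p - 1) with hA
  set w := dX fun z => lnp p (U z) with hw
  have sw : ContDiffOn ℝ (⊤ : ℕ∞) w (univ ×ˢ Ioo 0 T) := contDiffOn_dX hL
  have sw₁ := contDiffOn_dX sw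
  have sw₂ := contDiffOn_dX sw₁
  set w₁ := dX w with hw₁
  set w₂ := dX w₁ with hw₂
  have sJ : ContDiffOn ℝ (⊤ : ℕ∞) (fun z => U z * (A z * w₂ z + p * (w z * w₁ z)))
      (univ ×ˢ Ioo 0 T) :=
    hsmooth.mul ((ha.mul sw₂).add (contDiffOn_const.mul (sw.mul sw₁)))
  set J := fun z => U z * (A z * w₂ z + p * (w z * w₁ z)) with hJ
  have sv := contDiffOn_dX sJ
  set v := dX J with hv
  have swt := contDiffOn_dT sw
  have hweq : ∀ t ∈ Ioo 0 T, ∀ x, w (x, t) = U (x, t) ^ (p - 2) * dX U (x, t) := by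
    intro t ht x
    have := (hasDerivAt_lnp p (show 0 < U (x, t) from hpos x t ht)).comp x
      (hasDerivAt_dX hsmooth ht x)
    exact (hasDerivAt_dX hL ht x).unique this
  have hA' : ∀ t ∈ Ioo 0 T, ∀ x, HasDerivAt (fun y => A (y, t)) ((p - 1) * w (x, t)) x := by
    intro t ht x
    have := (hasDerivAt_dX hsmooth ht x).rpow_const (p := p - 1) (Or.inl (hpos x t ht).ne')
    refine this.congr_deriv ?_
    rw [hweq t ht x, show p - 1 - 1 = p - 2 by ring]
    ring
  have hUA' : ∀ t ∈ Ioo 0 T, ∀ x,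
      HasDerivAt (fun y => U (y, t) * A (y, t)) (p * (U (x, t) * w (x, t))) x := by
    intro t ht x
    have hu := hpos x t ht
    refine ((hasDerivAt_dX hsmooth ht x).mul (hA' t ht x)).congr_deriv ?_
    have e : A (x, t) = U (x, t) * U (x, t) ^ (p - 2) := by
      have := Real.rpow_add (show 0 < U (x, t) from hu) 1 (p - 2)
      rw [Real.rpow_one] at this
      rw [← this]
      show U (x, t) ^ (p - 1) = _
      congr 1
      ring
    rw [e, hweq t ht x]
    ring
  have hprof : ∀ t ∈ Ioo 0 T, ∀ x, HasDerivAt (fun y => U (y, t) * A (y, t) * w₁ (y, t))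
      (J (x, t)) x := by
    intro t ht x
    refine ((hUA' t ht x).mul (hasDerivAt_dX sw₁ ht x)).congr_deriv ?_
    simp only [hJ, ← hw₂]
    ring
  have hLw : ∀ t ∈ Ioo 0 T, deriv (fun z => lnp p (u z t)) = fun x => w (x, t) :=
    fun t ht => funext fun x => (hasDerivAt_dX hL ht x).deriv
  have hut : ∀ t ∈ Ioo 0 T, ∀ x, HasDerivAt (fun s => u x s) (-v (x, t)) t := by
    intro t ht x
    have h1 := hasDerivAt_dT hsmooth ht x
    have h2 := hpde x t ht
    have e1 : deriv (deriv fun w => lnp p (u w t)) = fun x => w₁ (x, t) := by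
      rw [hLw t ht]
      exact funext fun x => (hasDerivAt_dX sw ht x).deriv
    have e2 : (fun z => u z t ^ p * deriv (deriv fun w => lnp p (u w t)) z)
        = fun z => U (z, t) * A (z, t) * w₁ (z, t) := by
      rw [e1]
      funext z
      have : u z t ^ p = U (z, t) * A (z, t) := by
        have := Real.rpow_add (hpos z t ht) 1 (p - 1)
        rw [Real.rpow_one] at this
        rw [← add_sub_cancel 1 p]
        rw [this]
        simp [hA, hU]
      rw [this]
    have e3 : deriv (fun z => U (z, t) * A (z, t) * w₁ (z, t)) = fun x => J (x, t) :=
      funext fun x => (hprof t ht x).deriv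
    rw [e2, e3, (hasDerivAt_dX sJ ht x).deriv] at h2
    rw [← h2]
    exact h1.differentiableAt.hasDerivAt
  refine ⟨fun t x => A (x, t), fun t x => w (x, t), fun t x => w₁ (x, t), fun t x => w₂ (x, t),
    fun t x => v (x, t), fun t x => dT w (x, t), ⟨?_, hut, fun t ht x => hasDerivAt_dT sw ht x, ?_,
    hsmooth.continuousOn, sw.continuousOn, sv.continuousOn, swt.continuousOn⟩,
    fun t ht x => congrFun (hLw t ht) x⟩
  · intro t ht
    exact
      { pos := fun x => hpos x t ht
        a_eq := fun x => rfl
        continuous_u := continuous_slice hsmooth ht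
        continuous_a := continuous_slice ha ht
        hasDerivAt_ua := hUA' t ht
        hasDerivAt_a := hA' t ht
        hasDerivAt_w := hasDerivAt_dX sw ht
        hasDerivAt_w₁ := hasDerivAt_dX sw₁ ht
        continuous_w₂ := continuous_slice sw₂ ht
        hasDerivAt_flux := hasDerivAt_dX sJ ht
        continuous_v := continuous_slice sv ht
        integrable := (hdens t ht).1
        integral_eq := (hdens t ht).2 }
  · intro t ht x
    have h1 := hasDerivAt_dX (contDiffOn_dT hL) ht x
    rw [← dT_dX hL ht x] at h1
    refine h1.congr_of_eventuallyEq (Eventually.of_forall fun y => ?_)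
    have hu := hpos y t ht
    have h2 := (hasDerivAt_dT hL ht y).unique ((hasDerivAt_lnp p hu).comp t (hut t ht y))
    show _ = dT _ (y, t)
    rw [h2]
    have e : u y t ^ (p - 1) = u y t * u y t ^ (p - 2) := by
      have := Real.rpow_add hu 1 (p - 2)
      rw [Real.rpow_one] at this
      rw [← this]
      congr 1
      ring
    simp only [hA, hU, Function.uncurry_apply_pair]
    rw [e]
    field_simp

section Flow

variable {p T δ : ℝ} {u a w w₁ w₂ v wt : ℝ → ℝ → ℝ} {χ χ₁ χ₂ φ φ₁ φ₂ : ℝ → ℝ}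

theorem continuous_slice_of_continuousOn {F : ℝ → ℝ → ℝ}
    (hF : ContinuousOn (fun z : ℝ × ℝ => F z.2 z.1) (univ ×ˢ Ioo 0 T)) {t : ℝ}
    (ht : t ∈ Ioo 0 T) : Continuous (F t) :=
  hF.comp_continuous (f := fun x : ℝ => (x, t)) (by fun_prop) fun x => ⟨mem_univ _, ht⟩

theorem hasDerivAt_integral_mul (hφ : Continuous φ) (hs : HasCompactSupport φ)
    {F F' : ℝ → ℝ → ℝ}
    (hF : ContinuousOn (fun z : ℝ × ℝ => F z.2 z.1) (univ ×ˢ Ioo 0 T))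
    (hF' : ContinuousOn (fun z : ℝ × ℝ => F' z.2 z.1) (univ ×ˢ Ioo 0 T))
    (hd : ∀ t ∈ Ioo 0 T, ∀ x, HasDerivAt (fun s => F s x) (F' t x) t) {t : ℝ}
    (ht : t ∈ Ioo 0 T) :
    HasDerivAt (fun s => ∫ x, φ x * F s x) (∫ x, φ x * F' t x) t := by
  obtain ⟨ε, hε, hb⟩ := Metric.nhds_basis_closedBall.mem_iff.1 (isOpen_Ioo.mem_nhds ht)
  obtain ⟨C, hC⟩ := (hs.isCompact.prod (isCompact_closedBall t ε)).exists_bound_of_continuousOn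
    (hF'.mono (prod_mono (subset_univ _) hb))
  have hmem : ∀ᶠ s in nhds t, s ∈ Ioo 0 T := isOpen_Ioo.mem_nhds ht
  have hbd : ∀ x, ∀ s ∈ Metric.closedBall t ε, ‖φ x * F' s x‖ ≤ C * ‖φ x‖ := by
    intro x s hsb
    by_cases hx : x ∈ tsupport φ
    · rw [norm_mul, mul_comm]
      gcongr
      exact hC (x, s) ⟨hx, hsb⟩
    · simp [image_eq_zero_of_notMem_tsupport hx]
  refine (hasDerivAt_integral_of_dominated_loc_of_deriv_le
    (F := fun s x => φ x * F s x) (F' := fun s x => φ x * F' s x) (bound := fun x => C * ‖φ x‖)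
    (Metric.closedBall_mem_nhds t hε) ?_ ?_ ?_ (Eventually.of_forall hbd) ?_ ?_).2
  · filter_upwards [hmem] with s hs'
    exact (hφ.mul (continuous_slice_of_continuousOn hF hs')).aestronglyMeasurable
  · exact (hφ.mul (continuous_slice_of_continuousOn hF ht)).integrable_of_hasCompactSupport
      hs.mul_right
  · exact (hφ.mul (continuous_slice_of_continuousOn hF' ht)).aestronglyMeasurable
  · exact (hφ.norm.integrable_of_hasCompactSupport hs.norm).const_mul C
  · exact Eventually.of_forall fun x s hsb => (hd s (hb hsb) x).const_mul (φ x)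

theorem IsProfile.hasDerivAt_u {u a w w₁ w₂ v : ℝ → ℝ} (h : IsProfile p u a w w₁ w₂ v) (x : ℝ) :
    HasDerivAt u (u x * w x / a x) x := by
  have := (h.hasDerivAt_ua x).div (h.hasDerivAt_a x) (h.a_pos x).ne'
  have ha := (h.a_pos x).ne'
  refine (this.congr_of_eventuallyEq (Eventually.of_forall fun y => ?_)).congr_deriv ?_
  · have := (h.a_pos y).ne'
    simp only [Pi.div_apply]
    field_simp
  · field_simp
    ring

theorem IsProfile.energy_identity {u a w w₁ w₂ v wt : ℝ → ℝ} (h : IsProfile p u a w w₁ w₂ v)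
    (hrate : ∀ x, HasDerivAt (fun y => -(a y * v y / u y)) (wt x) x) (cwt : Continuous wt)
    (hφ : ∀ x, HasDerivAt φ (φ₁ x) x) (hφ₁ : ∀ x, HasDerivAt φ₁ (φ₂ x) x) (hφ₂ : Continuous φ₂)
    (hs : HasCompactSupport φ) :
    ∫ x, φ x * (-v x * w x ^ 2 + u x * (2 * w x * wt x)) =
      2 * ∫ x, -(u x * (a x * w₂ x + p * (w x * w₁ x)))
        * (φ x * (a x * w₂ x + p * (w x * w₁ x))
          + φ₁ x * (2 * (a x * w₁ x) + (p - 1 / 2) * w x ^ 2)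
          + φ₂ x * (a x * w x)) := by
  have cu := h.continuous_u
  have ca := h.continuous_a
  have cw := h.continuous_w
  have cw₁ := h.continuous_w₁
  have cw₂ := h.continuous_w₂
  have cv := h.continuous_v
  have cφ : Continuous φ := continuous_iff_continuousAt.2 fun x => (hφ x).continuousAt
  have cφ₁ : Continuous φ₁ := continuous_iff_continuousAt.2 fun x => (hφ₁ x).continuousAt
  have hs₁ : HasCompactSupport φ₁ := (funext fun x => (hφ x).deriv : deriv φ = φ₁) ▸ hs.deriv
  have hs₂ : HasCompactSupport φ₂ := (funext fun x => (hφ₁ x).deriv : deriv φ₁ = φ₂) ▸ hs₁.deriv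
  have hd₁ : ∀ x, HasDerivAt (fun y => φ y * ((u y * w y) * (-(a y * v y / u y)))) _ x := fun x =>
    (hφ x).mul (((h.hasDerivAt_u x).mul (h.hasDerivAt_w x)).mul (hrate x))
  have hd₂ : ∀ x, HasDerivAt (fun y => (u y * (a y * w₂ y + p * (w y * w₁ y)))
      * (φ₁ y * (a y * w y) + φ y * (a y * w₁ y + 1 / 2 * w y ^ 2))) _ x := fun x =>
    (h.hasDerivAt_flux x).mul (((hφ₁ x).mul ((h.hasDerivAt_a x).mul (h.hasDerivAt_w x))).add
      ((hφ x).mul (((h.hasDerivAt_a x).mul (h.hasDerivAt_w₁ x)).add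
        (((h.hasDerivAt_w x).pow 2).const_mul (1 / 2)))))
  have hI1 : Integrable fun x => φ x * (-v x * w x ^ 2 + u x * (2 * w x * wt x)) :=
    Continuous.integrable_of_hasCompactSupport (by fun_prop) hs.mul_right
  have hI2 : Integrable fun x => -(u x * (a x * w₂ x + p * (w x * w₁ x)))
        * (φ x * (a x * w₂ x + p * (w x * w₁ x))
          + φ₁ x * (2 * (a x * w₁ x) + (p - 1 / 2) * w x ^ 2)
          + φ₂ x * (a x * w x)) :=
    Continuous.integrable_of_hasCompactSupport (by fun_prop)
      ((hs.mul_right.add hs₁.mul_right).add hs₂.mul_right).mul_left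
  have hne : ∀ y, u y ≠ 0 := fun y => (h.pos y).ne'
  have hI3 : Integrable fun y => 2 * (φ y * ((u y * w y) * (-(a y * v y / u y)))
      + (u y * (a y * w₂ y + p * (w y * w₁ y)))
      * (φ₁ y * (a y * w y) + φ y * (a y * w₁ y + 1 / 2 * w y ^ 2))) :=
    Continuous.integrable_of_hasCompactSupport (by fun_prop (disch := exact hne _))
      (hs.mul_right.add (hs₁.mul_right.add hs.mul_right).mul_left).mul_left
  have key := integral_eq_zero_of_hasDerivAt_of_integrable
    (f' := fun x => φ x * (-v x * w x ^ 2 + u x * (2 * w x * wt x))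
      - 2 * (-(u x * (a x * w₂ x + p * (w x * w₁ x)))
        * (φ x * (a x * w₂ x + p * (w x * w₁ x))
          + φ₁ x * (2 * (a x * w₁ x) + (p - 1 / 2) * w x ^ 2)
          + φ₂ x * (a x * w x))))
    (fun x => (((hd₁ x).add (hd₂ x)).const_mul 2).congr_deriv ?_) (hI1.sub (hI2.const_mul 2)) hI3
  · rw [integral_sub hI1 (hI2.const_mul 2), integral_const_mul] at key
    linarith
  · have hu := hne x
    have ha := (h.a_pos x).ne'
    simp only [Pi.mul_apply]
    field_simp
    ring

theorem IsCutoff.hasDerivAt_pow_deriv (hc : IsCutoff δ χ χ₁ χ₂) (n : ℕ) (x : ℝ) :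
    HasDerivAt (fun y => χ y ^ (n + 1) * χ₁ y)
      ((n + 1 : ℝ) * (χ x ^ n * χ₁ x) * χ₁ x + χ x ^ (n + 1) * χ₂ x) x :=
  (hc.hasDerivAt_pow n x).mul (hc.hasDerivAt₁ x)

/-- Localized Fisher information is almost non-increasing. -/
theorem localized_fisher_le (hp : 1 ≤ p) {q : ℕ} (hq : p - 1 ≤ q) :
    ∃ K δ₀ : ℝ, 0 < K ∧ 0 < δ₀ ∧
    ∀ (T δ : ℝ) (u a w w₁ w₂ v wt : ℝ → ℝ → ℝ) (χ χ₁ χ₂ : ℝ → ℝ),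
      IsFlow p T u a w w₁ w₂ v wt → IsCutoff δ χ χ₁ χ₂ → δ ≤ δ₀ →
      ∀ t₀ ∈ Ioo 0 T, ∀ t ∈ Ioo 0 T, t₀ ≤ t →
        ∫ x, χ x ^ (8 * q + 8) * (u t x * w t x ^ 2)
          ≤ (∫ x, χ x ^ (8 * q + 8) * (u t₀ x * w t₀ x ^ 2)) + K * δ ^ 2 * (t - t₀) := by
  obtain ⟨K, δ₀, hK, hδ₀, hE⟩ := energy_rate_le hp hq
  refine ⟨2 * K, δ₀, by positivity, hδ₀, ?_⟩
  intro T δ u a w w₁ w₂ v wt χ χ₁ χ₂ h hc hδ t₀ ht₀ t ht htt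
  have cχ := hc.continuous
  have hd : ∀ s ∈ Ioo 0 T, HasDerivAt (fun s => ∫ x, χ x ^ (8 * q + 8) * (u s x * w s x ^ 2))
      (∫ x, χ x ^ (8 * q + 8) * (-v s x * w s x ^ 2 + u s x * (2 * w s x * wt s x))) s := by
    intro s hs
    refine hasDerivAt_integral_mul (T := T) (by fun_prop)
      (hc.compactSupport_of_zero fun x hx => by simp [hx]) (F := fun s x => u s x * w s x ^ 2)
      (F' := fun s x => -v s x * w s x ^ 2 + u s x * (2 * w s x * wt s x))
      (h.continuousOn_u.mul (h.continuousOn_w.pow 2))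
      ((h.continuousOn_v.neg.mul (h.continuousOn_w.pow 2)).add
        (h.continuousOn_u.mul ((continuousOn_const.mul h.continuousOn_w).mul h.continuousOn_wt)))
      ?_ hs
    intro t ht x
    refine ((h.hasDerivAt_u t ht x).mul ((h.hasDerivAt_w t ht x).pow 2)).congr_deriv ?_
    simp
  have hle : ∀ s ∈ Ioo 0 T,
      ∫ x, χ x ^ (8 * q + 8) * (-v s x * w s x ^ 2 + u s x * (2 * w s x * wt s x))
        ≤ 2 * K * δ ^ 2 := by
    intro s hs
    have hφ : ∀ x, HasDerivAt (fun y => χ y ^ (8 * q + 8))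
        ((8 * q + 8 : ℝ) * (χ x ^ (8 * q + 7) * χ₁ x)) x := fun x =>
      (hc.hasDerivAt_pow (8 * q + 7) x).congr_deriv (by push_cast; ring)
    have hφ₁ : ∀ x, HasDerivAt (fun y => (8 * q + 8 : ℝ) * (χ y ^ (8 * q + 7) * χ₁ y))
        ((8 * q + 8) * ((8 * q + 7) * (χ x ^ (8 * q + 6) * χ₁ x) * χ₁ x
            + χ x ^ (8 * q + 7) * χ₂ x)) x := fun x =>
      ((hc.hasDerivAt_pow_deriv (8 * q + 6) x).const_mul _).congr_deriv (by push_cast; ring)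
    have cχ₁ := hc.continuous₁
    have cχ₂ := hc.continuous₂
    rw [(h.profile s hs).energy_identity (h.hasDerivAt_rate s hs)
      (continuous_slice_of_continuousOn h.continuousOn_wt hs) hφ hφ₁ (by fun_prop)
      (hc.compactSupport_of_zero fun x hx => by simp [hx])]
    have := hE δ _ _ _ _ _ _ _ _ _ (h.profile s hs) hc hδ
    linarith
  have := Convex.image_sub_le_mul_sub_of_deriv_le (convex_Icc t₀ t)
    (f := fun s => ∫ x, χ x ^ (8 * q + 8) * (u s x * w s x ^ 2)) (C := 2 * K * δ ^ 2)
    (fun s hs => (hd s ⟨ht₀.1.trans_le hs.1, hs.2.trans_lt ht.2⟩).continuousAt.continuousWithinAt)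
    (fun s hs => by
      rw [interior_Icc] at hs
      exact (hd s ⟨ht₀.1.trans hs.1, hs.2.trans ht.2⟩).differentiableAt.differentiableWithinAt)
    (fun s hs => by
      rw [interior_Icc] at hs
      have hs' : s ∈ Ioo 0 T := ⟨ht₀.1.trans hs.1, hs.2.trans ht.2⟩
      rw [(hd s hs').deriv]
      exact hle s hs') t₀ ⟨le_rfl, htt⟩ t ⟨htt, le_rfl⟩ htt
  linarith

end Flow

theorem exists_bound_of_tendsto_cocompact {f : ℝ → ℝ} (hf : Continuous f)
    (h : Tendsto f (cocompact ℝ) (nhds 0)) : ∃ C, ∀ x, |f x| ≤ C := by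
  obtain ⟨C, hC⟩ := (isBounded_iff_forall_norm_le.1
    (ZeroAtInftyContinuousMap.isBounded_range (⟨⟨f, hf⟩, h⟩ : ZeroAtInftyContinuousMap ℝ ℝ)))
  exact ⟨C, fun x => hC (f x) ⟨x, rfl⟩⟩

/-- A nonnegative function with bounded second derivative has `g' ^ 2 ≤ 2 * C * g`. -/
theorem sq_deriv_le_of_abs_deriv2_le {g g₁ g₂ : ℝ → ℝ} {C : ℝ} (hC : 0 < C) (h0 : ∀ x, 0 ≤ g x)
    (hg : ∀ x, HasDerivAt g (g₁ x) x) (hg₁ : ∀ x, HasDerivAt g₁ (g₂ x) x)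
    (hb : ∀ x, |g₂ x| ≤ C) (x : ℝ) : g₁ x ^ 2 ≤ 2 * C * g x := by
  have hlip : ∀ y, |g₁ y - g₁ x| ≤ C * |y - x| := fun y =>
    convex_univ.norm_image_sub_le_of_norm_hasDerivWithin_le
      (fun z _ => (hg₁ z).hasDerivWithinAt) (fun z _ => hb z) (mem_univ x) (mem_univ y)
  set d := -(g₁ x) / C with hd
  have hm : ∀ s, HasDerivAt (fun s => g (x + s * d) - s * (d * g₁ x) - C * d ^ 2 / 2 * s ^ 2)
      (g₁ (x + s * d) * d - d * g₁ x - C * d ^ 2 * s) s := fun s => by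
    have i1 : HasDerivAt (fun s => x + s * d) d s := by
      simpa using ((hasDerivAt_id s).mul_const d).const_add x
    have i2 : HasDerivAt (fun s => g (x + s * d)) (g₁ (x + s * d) * d) s := (hg _).comp s i1
    refine ((i2.sub ((hasDerivAt_id s).mul_const (d * g₁ x))).sub
      (((hasDerivAt_id s).pow 2).const_mul (C * d ^ 2 / 2))).congr_deriv ?_
    simp
    ring
  have := Convex.image_sub_le_mul_sub_of_deriv_le (convex_Icc (0:ℝ) 1) (C := 0)
    (fun s _ => (hm s).continuousAt.continuousWithinAt)
    (fun s _ => (hm s).differentiableAt.differentiableWithinAt)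
    (fun s hs => by
      rw [interior_Icc] at hs
      rw [(hm s).deriv]
      have := hlip (x + s * d)
      rw [add_sub_cancel_left, abs_mul, abs_of_pos hs.1] at this
      have i : (g₁ (x + s * d) - g₁ x) * d ≤ C * (s * |d|) * |d| :=
        calc _ ≤ |(g₁ (x + s * d) - g₁ x) * d| := le_abs_self _
          _ = |g₁ (x + s * d) - g₁ x| * |d| := abs_mul _ _
          _ ≤ _ := by gcongr
      have e : C * (s * |d|) * |d| = C * d ^ 2 * s := by
        rw [← sq_abs d]; ring
      linarith) 0 ⟨le_rfl, zero_le_one⟩ 1 ⟨zero_le_one, le_rfl⟩ zero_le_one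
  have h1 := h0 (x + 1 * d)
  have e1 : C * d ^ 2 / 2 = g₁ x ^ 2 / (2 * C) := by rw [hd]; field_simp
  have e2 : d * g₁ x = -(g₁ x ^ 2 / C) := by rw [hd]; ring
  have e3 : g₁ x ^ 2 / C = 2 * (g₁ x ^ 2 / (2 * C)) := by field_simp
  norm_num at this
  rw [e1, e2, e3] at this
  norm_num at h1
  have h2 : g₁ x ^ 2 / (2 * C) ≤ g x := by linarith
  rwa [div_le_iff₀ (by positivity), mul_comm] at h2

theorem IsProfile.integrable_fisher {p : ℝ} {u a w w₁ w₂ v : ℝ → ℝ}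
    (h : IsProfile p u a w w₁ w₂ v) (hp : 1 ≤ p) (hdec : RapidDecay u) :
    Integrable fun x => u x * w x ^ 2 := by
  have cu := h.continuous_u
  have ca := h.continuous_a
  have cw := h.continuous_w
  have cw₁ := h.continuous_w₁
  have hane : ∀ x, a x ≠ 0 := fun x => (h.a_pos x).ne'
  set d := fun x => u x * w x / a x with hd
  have hud : ∀ x, HasDerivAt u (d x) x := h.hasDerivAt_u
  obtain ⟨d₂, cd₂, hd₂⟩ : ∃ d₂ : ℝ → ℝ, Continuous d₂ ∧ ∀ x, HasDerivAt d (d₂ x) x := by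
    refine ⟨_, ?_, fun x => ((hud x).mul (h.hasDerivAt_w x)).div (h.hasDerivAt_a x) (hane x)⟩
    simp only [hd, Pi.mul_apply]
    have : Continuous fun x => u x * w x / a x := (cu.mul cw).div ca hane
    exact Continuous.div (by fun_prop) (by fun_prop) fun x => pow_ne_zero 2 (hane x)
  have cd : Continuous d := continuous_iff_continuousAt.2 fun x => (hd₂ x).continuousAt
  have e1 : iteratedDeriv 1 u = d := by
    rw [iteratedDeriv_one]; exact funext fun x => (hud x).deriv
  have e2 : iteratedDeriv 2 u = d₂ := by
    rw [iteratedDeriv_succ, e1]; exact funext fun x => (hd₂ x).deriv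
  obtain ⟨M, hM⟩ : ∃ C, ∀ x, |x ^ 0 * u x| ≤ C :=
    exists_bound_of_tendsto_cocompact (by fun_prop) (by simpa using hdec 0 0)
  obtain ⟨M₁, hM₁⟩ : ∃ C, ∀ x, |x ^ 1 * d x| ≤ C :=
    exists_bound_of_tendsto_cocompact (by fun_prop) (by simpa [e1] using hdec 1 1)
  obtain ⟨M₂, hM₂⟩ : ∃ C, ∀ x, |x ^ 0 * d₂ x| ≤ C :=
    exists_bound_of_tendsto_cocompact (by fun_prop) (by simpa [e2] using hdec 0 2)
  obtain ⟨M₃, hM₃⟩ : ∃ C, ∀ x, |x ^ 2 * d₂ x| ≤ C :=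
    exists_bound_of_tendsto_cocompact (by fun_prop) (by simpa [e2] using hdec 2 2)
  simp only [pow_zero, one_mul, pow_one] at hM hM₁ hM₂
  have hM0 : 0 ≤ M := (abs_nonneg _).trans (hM 0)
  have hM10 : 0 ≤ M₁ := (abs_nonneg _).trans (hM₁ 0)
  have hM20 : 0 ≤ M₂ := (abs_nonneg _).trans (hM₂ 0)
  have hM30 : 0 ≤ M₃ := (abs_nonneg _).trans (hM₃ 0)
  set C := 2 * M + 4 * M₁ + (M₂ + M₃) + 1 with hC
  have hV := sq_deriv_le_of_abs_deriv2_le (g := fun x => (1 + x ^ 2) * u x)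
    (g₁ := fun x => 2 * x * u x + (1 + x ^ 2) * d x)
    (g₂ := fun x => 2 * u x + 4 * (x * d x) + (d₂ x + x ^ 2 * d₂ x)) (C := C) (by positivity)
    (fun x => by have := h.pos x; positivity)
    (fun x => by
      refine ((((hasDerivAt_id x).pow 2).const_add 1).mul (hud x)).congr_deriv ?_
      simp)
    (fun x => by
      refine ((((hasDerivAt_id x).const_mul 2).mul (hud x)).add
        ((((hasDerivAt_id x).pow 2).const_add 1).mul (hd₂ x))).congr_deriv ?_
      simp
      ring)
    (fun x => by
      have i1 := abs_le.1 (hM x)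
      have i2 := abs_le.1 (hM₁ x)
      have i3 := abs_le.1 (hM₂ x)
      have i4 := abs_le.1 (hM₃ x)
      rw [abs_le]
      constructor <;> linarith [i1.1, i1.2, i2.1, i2.2, i3.1, i3.2, i4.1, i4.2])
  refine Integrable.mono' (g := fun x => (M ^ (p - 1)) ^ 2 * (4 * C * (1 + x ^ 2)⁻¹ + 8 * u x))
    (((integrable_inv_one_add_sq.const_mul _).add (h.integrable.const_mul _)).const_mul _)
    (by fun_prop) (Eventually.of_forall fun x => ?_)
  have hu := h.pos x
  have ha := h.a_pos x
  have hVx := hV x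
  have hw : u x * w x ^ 2 = a x ^ 2 * (d x ^ 2 / u x) := by
    simp only [hd]
    field_simp
  have haM : a x ≤ M ^ (p - 1) := by
    rw [h.a_eq]
    exact Real.rpow_le_rpow hu.le ((le_abs_self _).trans (hM x)) (by linarith)
  rw [Real.norm_of_nonneg (by positivity), hw]
  have hdu : d x ^ 2 / u x ≤ 4 * C * (1 + x ^ 2)⁻¹ + 8 * u x := by
    rw [div_le_iff₀ hu, ← div_eq_mul_inv]
    have hx : 0 < 1 + x ^ 2 := by positivity
    have j : d x ^ 2 * (1 + x ^ 2) ^ 2 ≤ 4 * C * u x * (1 + x ^ 2) + 8 * u x ^ 2 * (1 + x ^ 2) ^ 2 := by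
      have j1 : 0 ≤ (2 * (2 * x * u x) + (1 + x ^ 2) * d x) ^ 2 := sq_nonneg _
      have j2 : 0 ≤ u x ^ 2 * (1 + x ^ 2 + x ^ 4) := by positivity
      have j3 : 8 * (x ^ 2 * u x ^ 2) ≤ 8 * u x ^ 2 * (1 + x ^ 2) ^ 2 := by
        have : 0 ≤ u x ^ 2 * (1 + x ^ 2 + x ^ 4) := by positivity
        linarith
      linarith
    have e : (4 * C / (1 + x ^ 2) + 8 * u x) * u x
        = (4 * C * u x * (1 + x ^ 2) + 8 * u x ^ 2 * (1 + x ^ 2) ^ 2) / (1 + x ^ 2) ^ 2 := by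
      field_simp
    rw [e, le_div_iff₀ (by positivity)]
    exact j
  gcongr

/-- A `C³` function `ρ` with derivatives `ρ₁, ρ₂, ρ₃` bounded by `C`, equal to `1` on `[-1, 1]`,
vanishing outside `[-2, 2]` and with values in `[0, 1]`. -/
structure IsBump (C : ℝ) (ρ ρ₁ ρ₂ ρ₃ : ℝ → ℝ) : Prop where
  hasDerivAt : ∀ x, HasDerivAt ρ (ρ₁ x) x
  hasDerivAt₁ : ∀ x, HasDerivAt ρ₁ (ρ₂ x) x
  hasDerivAt₂ : ∀ x, HasDerivAt ρ₂ (ρ₃ x) x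
  continuous₃ : Continuous ρ₃
  nonneg : ∀ x, 0 ≤ ρ x
  le_one : ∀ x, ρ x ≤ 1
  eq_one : ∀ x, |x| ≤ 1 → ρ x = 1
  eq_zero : ∀ x, 2 ≤ |x| → ρ x = 0
  abs_le₁ : ∀ x, |ρ₁ x| ≤ C
  abs_le₂ : ∀ x, |ρ₂ x| ≤ C
  abs_le₃ : ∀ x, |ρ₃ x| ≤ C

theorem exists_isBump : ∃ (C : ℝ) (ρ ρ₁ ρ₂ ρ₃ : ℝ → ℝ), 0 < C ∧ IsBump C ρ ρ₁ ρ₂ ρ₃ := by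
  let f : ContDiffBump (0 : ℝ) := ⟨1, 2, zero_lt_one, one_lt_two⟩
  have hs : ∀ n, ContDiff ℝ (⊤ : ℕ∞) (iteratedDeriv n f) := fun n =>
    (f.contDiff (n := (⊤ : ℕ∞))).iterate_deriv n |> fun h => by
      simpa [iteratedDeriv_eq_iterate] using h
  have hd : ∀ n x, HasDerivAt (iteratedDeriv n f) (iteratedDeriv (n + 1) f x) x := fun n x => by
    rw [iteratedDeriv_succ]
    exact ((hs n).differentiable (by simp) x).hasDerivAt
  have hcs : ∀ n, HasCompactSupport (iteratedDeriv n f) := fun n => by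
    induction n with
    | zero => simpa using f.hasCompactSupport
    | succ n ih => rw [iteratedDeriv_succ]; exact ih.deriv
  have hb : ∀ n, ∃ C, ∀ x, ‖iteratedDeriv n f x‖ ≤ C := fun n =>
    (hcs n).exists_bound_of_continuous (hs n).continuous
  obtain ⟨C₁, h₁⟩ := hb 1
  obtain ⟨C₂, h₂⟩ := hb 2
  obtain ⟨C₃, h₃⟩ := hb 3
  have p₁ : 0 ≤ C₁ := (norm_nonneg _).trans (h₁ 0)
  have p₂ : 0 ≤ C₂ := (norm_nonneg _).trans (h₂ 0)
  have p₃ : 0 ≤ C₃ := (norm_nonneg _).trans (h₃ 0)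
  refine ⟨C₁ + C₂ + C₃ + 1, f, iteratedDeriv 1 f, iteratedDeriv 2 f, iteratedDeriv 3 f,
    by positivity, ?_⟩
  exact
    { hasDerivAt := fun x => by simpa using hd 0 x
      hasDerivAt₁ := hd 1
      hasDerivAt₂ := hd 2
      continuous₃ := (hs 3).continuous
      nonneg := fun x => f.nonneg
      le_one := fun x => f.le_one
      eq_one := fun x hx => f.one_of_mem_closedBall (by simpa using hx)
      eq_zero := fun x hx => f.zero_of_le_dist (by simpa using hx)
      abs_le₁ := fun x => (h₁ x).trans (by linarith)
      abs_le₂ := fun x => (h₂ x).trans (by linarith)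
      abs_le₃ := fun x => (h₃ x).trans (by linarith) }

section Bump

variable {C : ℝ} {ρ ρ₁ ρ₂ ρ₃ : ℝ → ℝ}

theorem hasDerivAt_comp_div {f f' : ℝ → ℝ} (hf : ∀ x, HasDerivAt f (f' x) x) (R x : ℝ) :
    HasDerivAt (fun y => f (y / R)) (f' (x / R) / R) x := by
  have : HasDerivAt (fun y => f (y / R)) (f' (x / R) * (1 / R)) x :=
    (hf (x / R)).comp x ((hasDerivAt_id x).div_const R)
  rwa [mul_one_div] at this

theorem IsBump.continuous (hρ : IsBump C ρ ρ₁ ρ₂ ρ₃) : Continuous ρ :=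
  continuous_iff_continuousAt.2 fun x => (hρ.hasDerivAt x).continuousAt

theorem IsBump.continuous₂ (hρ : IsBump C ρ ρ₁ ρ₂ ρ₃) : Continuous ρ₂ :=
  continuous_iff_continuousAt.2 fun x => (hρ.hasDerivAt₂ x).continuousAt

theorem IsBump.hasCompactSupport (hρ : IsBump C ρ ρ₁ ρ₂ ρ₃) {R : ℝ} (hR : 0 < R) :
    HasCompactSupport fun x => ρ (x / R) := by
  refine HasCompactSupport.intro (isCompact_closedBall (0 : ℝ) (2 * R)) fun x hx => ?_
  apply hρ.eq_zero
  rw [abs_div, abs_of_pos hR, le_div_iff₀ hR]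
  simpa using (not_le.1 (by simpa using hx) : 2 * R < |x|).le

theorem IsBump.tendsto (hρ : IsBump C ρ ρ₁ ρ₂ ρ₃) (x : ℝ) :
    Tendsto (fun n : ℕ => ρ (x / n)) atTop (nhds 1) := by
  refine tendsto_const_nhds.congr' ?_
  filter_upwards [eventually_ge_atTop (max 1 ⌈|x|⌉₊)] with n hn
  have h1 : (1 : ℝ) ≤ n := by exact_mod_cast (le_max_left _ _).trans hn
  have h2 : |x| ≤ n := (Nat.le_ceil _).trans (by exact_mod_cast (le_max_right _ _).trans hn)
  rw [hρ.eq_one]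
  rw [abs_div, Nat.abs_cast, div_le_one (by linarith)]
  exact h2

theorem IsBump.isCutoff (hρ : IsBump C ρ ρ₁ ρ₂ ρ₃) {R : ℝ} (hR : 1 ≤ R) :
    IsCutoff (C / R) (fun x => ρ (x / R)) (fun x => ρ₁ (x / R) / R)
      (fun x => ρ₂ (x / R) / R / R) := by
  have hR0 : 0 < R := by linarith
  have hC : 0 ≤ C := (abs_nonneg _).trans (hρ.abs_le₁ 0)
  have := hρ.continuous₂
  exact
    { hasDerivAt := hasDerivAt_comp_div hρ.hasDerivAt R
      hasDerivAt₁ := fun x => (hasDerivAt_comp_div hρ.hasDerivAt₁ R x).div_const R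
      continuous₂ := by fun_prop
      compact := hρ.hasCompactSupport hR0
      nonneg := fun x => hρ.nonneg _
      le_one := fun x => hρ.le_one _
      abs_le₁ := fun x => by
        rw [abs_div, abs_of_pos hR0]
        have := hρ.abs_le₁ (x / R)
        gcongr
      abs_le₂ := fun x => by
        rw [abs_div, abs_div, abs_of_pos hR0]
        have := hρ.abs_le₂ (x / R)
        calc |ρ₂ (x / R)| / R / R ≤ C / R / 1 := by gcongr
          _ = C / R := div_one _ }

theorem IsBump.isCutoff_sub (hρ : IsBump C ρ ρ₁ ρ₂ ρ₃) {R S : ℝ} (hR : 1 ≤ R) (hS : 2 * R ≤ S) :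
    IsCutoff (2 * C / R) (fun x => ρ (x / S) - ρ (x / R)) (fun x => ρ₁ (x / S) / S - ρ₁ (x / R) / R)
      (fun x => ρ₂ (x / S) / S / S - ρ₂ (x / R) / R / R) := by
  have hR0 : 0 < R := by linarith
  have hC : 0 ≤ C := (abs_nonneg _).trans (hρ.abs_le₁ 0)
  have h1 := hρ.isCutoff hR
  have h2 := hρ.isCutoff (show 1 ≤ S by linarith)
  have hRS : C / S ≤ C / R := by
    gcongr
    linarith
  have e : 2 * C / R = C / R + C / R := by ring
  exact
    { hasDerivAt := fun x => (h2.hasDerivAt x).sub (h1.hasDerivAt x)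
      hasDerivAt₁ := fun x => (h2.hasDerivAt₁ x).sub (h1.hasDerivAt₁ x)
      continuous₂ := h2.continuous₂.sub h1.continuous₂
      compact := h2.compact.sub h1.compact
      nonneg := fun x => by
        rcases le_or_gt 2 |x / R| with h | h
        · simpa [hρ.eq_zero _ h] using hρ.nonneg _
        · have : ρ (x / S) = 1 := by
            apply hρ.eq_one
            rw [abs_div, abs_of_pos hR0, div_lt_iff₀ hR0] at h
            rw [abs_div, abs_of_pos (show 0 < S by linarith), div_le_one (by linarith)]
            linarith
          rw [this]
          linarith [hρ.le_one (x / R)]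
      le_one := fun x => by linarith [hρ.le_one (x / S), hρ.nonneg (x / R)]
      abs_le₁ := fun x => by
        have i1 := h1.abs_le₁ x
        have i2 := h2.abs_le₁ x
        rw [e]
        exact (abs_sub _ _).trans (by linarith)
      abs_le₂ := fun x => by
        have i1 := h1.abs_le₂ x
        have i2 := h2.abs_le₂ x
        rw [e]
        exact (abs_sub _ _).trans (by linarith) }

end Bump

theorem tendsto_integral_pow_mul {f : ℝ → ℝ} (hf : Integrable f) (m : ℕ) {χ : ℕ → ℝ → ℝ}
    {χ' : ℝ → ℝ} (hc : ∀ᶠ n in atTop, Continuous (χ n)) (h0 : ∀ᶠ n in atTop, ∀ x, 0 ≤ χ n x)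
    (h1 : ∀ᶠ n in atTop, ∀ x, χ n x ≤ 1)
    (hlim : ∀ x, Tendsto (fun n => χ n x) atTop (nhds (χ' x))) :
    Tendsto (fun n => ∫ x, χ n x ^ m * f x) atTop (nhds (∫ x, χ' x ^ m * f x)) := by
  refine tendsto_integral_filter_of_dominated_convergence (fun x => |f x|) ?_ ?_ hf.abs
    (Eventually.of_forall fun x => ((hlim x).pow m).mul_const _)
  · filter_upwards [hc] with n hn
    exact (hn.pow m).aestronglyMeasurable.mul hf.aestronglyMeasurable
  · filter_upwards [h0, h1] with n h0 h1
    refine Eventually.of_forall fun x => ?_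
    rw [norm_mul, Real.norm_of_nonneg (pow_nonneg (h0 x) m), Real.norm_eq_abs]
    exact mul_le_of_le_one_left (abs_nonneg _) (pow_le_one₀ (h0 x) (h1 x))

section Tail

variable {p T C : ℝ} {u a w w₁ w₂ v wt : ℝ → ℝ → ℝ} {ρ ρ₁ ρ₂ ρ₃ : ℝ → ℝ}

/-- The Fisher information is non-increasing, and its tails are propagated uniformly in time. -/
theorem fisher_antitone_and_tail_le (hp : 1 ≤ p) {q : ℕ} (hq : p - 1 ≤ q)
    (hρ : IsBump C ρ ρ₁ ρ₂ ρ₃) : ∃ K R₀ : ℝ, 0 < K ∧ 1 ≤ R₀ ∧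
    ∀ (T : ℝ) (u a w w₁ w₂ v wt : ℝ → ℝ → ℝ), IsFlow p T u a w w₁ w₂ v wt →
      (∀ t ∈ Ioo 0 T, Integrable fun x => u t x * w t x ^ 2) →
      ∀ t₀ ∈ Ioo 0 T, ∀ t ∈ Ioo 0 T, t₀ ≤ t →
        (∫ x, u t x * w t x ^ 2 ≤ ∫ x, u t₀ x * w t₀ x ^ 2) ∧
        ∀ R, R₀ ≤ R → ∫ x, (1 - ρ (x / R)) ^ (8 * q + 8) * (u t x * w t x ^ 2)
          ≤ (∫ x, (1 - ρ (x / R)) ^ (8 * q + 8) * (u t₀ x * w t₀ x ^ 2))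
            + K * (2 * C / R) ^ 2 * (t - t₀) := by
  obtain ⟨K, δ₀, hK, hδ₀, hE⟩ := localized_fisher_le hp hq
  have cρ := hρ.continuous
  refine ⟨K, max 1 (2 * C / δ₀), hK, le_max_left _ _, ?_⟩
  intro T u a w w₁ w₂ v wt h hfish t₀ ht₀ t ht htt
  have hge : ∀ r : ℝ, ∀ᶠ n : ℕ in atTop, r ≤ n := fun r =>
    tendsto_natCast_atTop_atTop.eventually_ge_atTop r
  constructor
  · have hlim : ∀ s ∈ Ioo 0 T, Tendsto
        (fun n : ℕ => ∫ x, ρ (x / n) ^ (8 * q + 8) * (u s x * w s x ^ 2)) atTop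
        (nhds (∫ x, u s x * w s x ^ 2)) := fun s hs => by
      simpa using tendsto_integral_pow_mul (hfish s hs) (8 * q + 8)
        (χ := fun n x => ρ (x / n)) (χ' := fun _ => 1)
        (Eventually.of_forall fun n => by fun_prop)
        (Eventually.of_forall fun n x => hρ.nonneg _) (Eventually.of_forall fun n x => hρ.le_one _)
        hρ.tendsto
    have hz : Tendsto (fun n : ℕ => K * (C / n) ^ 2 * (t - t₀)) atTop (nhds 0) := by
      simpa using (((tendsto_const_div_atTop_nhds_zero_nat C).pow 2).const_mul K).mul_const (t - t₀)
    have := (hlim t₀ ht₀).add hz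
    rw [add_zero] at this
    refine le_of_tendsto_of_tendsto (hlim t ht) this ?_
    filter_upwards [hge 1, hge (C / δ₀)] with n h1 h2
    refine hE T _ u a w w₁ w₂ v wt _ _ _ h (hρ.isCutoff h1) ?_ t₀ ht₀ t ht htt
    rw [div_le_iff₀ hδ₀] at h2
    rw [div_le_iff₀ (by linarith)]
    linarith
  · intro R hR
    have hR1 : 1 ≤ R := (le_max_left _ _).trans hR
    have hlim : ∀ s ∈ Ioo 0 T, Tendsto
        (fun n : ℕ => ∫ x, (ρ (x / n) - ρ (x / R)) ^ (8 * q + 8) * (u s x * w s x ^ 2)) atTop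
        (nhds (∫ x, (1 - ρ (x / R)) ^ (8 * q + 8) * (u s x * w s x ^ 2))) := fun s hs => by
      refine tendsto_integral_pow_mul (hfish s hs) (8 * q + 8)
        (χ := fun n x => ρ (x / n) - ρ (x / R)) (χ' := fun x => 1 - ρ (x / R))
        (Eventually.of_forall fun n => by fun_prop) ?_ ?_
        fun x => (hρ.tendsto x).sub_const _
      · filter_upwards [hge (2 * R)] with n hn
        exact (hρ.isCutoff_sub hR1 hn).nonneg
      · filter_upwards [hge (2 * R)] with n hn
        exact (hρ.isCutoff_sub hR1 hn).le_one
    refine le_of_tendsto_of_tendsto (hlim t ht) ((hlim t₀ ht₀).add_const _) ?_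
    filter_upwards [hge (2 * R)] with n hn
    refine hE T _ u a w w₁ w₂ v wt _ _ _ h (hρ.isCutoff_sub hR1 hn) ?_ t₀ ht₀ t ht htt
    have h2 : 2 * C / δ₀ ≤ R := (le_max_right _ _).trans hR
    rw [div_le_iff₀ hδ₀] at h2
    rw [div_le_iff₀ (by linarith)]
    linarith

/-- The Fisher information controls the sup norm of `u ^ (p - 1)`. -/
theorem IsProfile.sup_le {u a w w₁ w₂ v : ℝ → ℝ} (h : IsProfile p u a w w₁ w₂ v) (hp : 1 ≤ p)
    (hρ : IsBump C ρ ρ₁ ρ₂ ρ₃) (hfish : Integrable fun x => u x * w x ^ 2) {τ : ℝ} (hτ : 1 ≤ τ)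
    (hW : ∫ x, u x * w x ^ 2 ≤ τ ^ 2) (x : ℝ) : a x ≤ (2 + 2 * p) * τ := by
  obtain ⟨q, hq⟩ := exists_nat_ge (p - 1)
  have hq0 : (0:ℝ) ≤ q := by positivity
  have hC : 0 ≤ C := (abs_nonneg _).trans (hρ.abs_le₁ 0)
  have hlim : Tendsto (fun n : ℕ => ρ (x / n) ^ (2 * q) * a x) atTop (nhds (a x)) := by
    simpa using ((hρ.tendsto x).pow (2 * q)).mul_const (a x)
  refine le_of_tendsto hlim ?_
  have hge : ∀ r : ℝ, ∀ᶠ n : ℕ in atTop, r ≤ n := fun r =>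
    tendsto_natCast_atTop_atTop.eventually_ge_atTop r
  filter_upwards [hge 1, hge ((4 * q + 4) * C)] with n h1 h2
  refine weighted_sup_le hp hq h (hρ.isCutoff h1) ?_ hτ (le_trans ?_ hW) x
  · rw [← mul_div_assoc, div_le_iff₀ (by linarith)]
    linarith
  · refine integral_mono_of_nonneg (Eventually.of_forall fun y => ?_) hfish
      (Eventually.of_forall fun y => ?_)
    · have := h.pos y
      have := hρ.nonneg (y / n)
      positivity
    · have := h.pos y
      exact mul_le_of_le_one_left (by positivity) (pow_le_one₀ (hρ.nonneg _) (hρ.le_one _))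

end Tail

theorem IsBump.exists_truncated_square {C : ℝ} {ρ ρ₁ ρ₂ ρ₃ : ℝ → ℝ}
    (hρ : IsBump C ρ ρ₁ ρ₂ ρ₃) : ∃ (ψ ψ₁ ψ₂ ψ₃ : ℝ → ℝ) (B : ℝ), 0 < B ∧
      (∀ x, HasDerivAt ψ (ψ₁ x) x) ∧ (∀ x, HasDerivAt ψ₁ (ψ₂ x) x) ∧
      (∀ x, HasDerivAt ψ₂ (ψ₃ x) x) ∧ Continuous ψ₃ ∧ HasCompactSupport ψ ∧
      (∀ x, |ψ x| ≤ x ^ 2) ∧ (∀ x, |x| ≤ 1 → ψ x = x ^ 2) ∧ (∀ x, |x| < 1 → ψ₂ x = 2) ∧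
      (∀ x, |ψ₂ x| ≤ B) ∧ ∀ x, |ψ₃ x| ≤ B := by
  have c₃ := hρ.continuous₃
  have c₂ := hρ.continuous₂
  have c₁ : Continuous ρ₁ := continuous_iff_continuousAt.2 fun x => (hρ.hasDerivAt₁ x).continuousAt
  have d₀ : ∀ x, HasDerivAt (fun y => y ^ 2 * ρ y) (2 * x * ρ x + x ^ 2 * ρ₁ x) x := fun x => by
    refine (((hasDerivAt_id x).pow 2).mul (hρ.hasDerivAt x)).congr_deriv ?_
    simp
  have d₁ : ∀ x, HasDerivAt (fun y => 2 * y * ρ y + y ^ 2 * ρ₁ y)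
      (2 * ρ x + 4 * x * ρ₁ x + x ^ 2 * ρ₂ x) x := fun x => by
    refine ((((hasDerivAt_id x).const_mul 2).mul (hρ.hasDerivAt x)).add
      (((hasDerivAt_id x).pow 2).mul (hρ.hasDerivAt₁ x))).congr_deriv ?_
    simp
    ring
  have d₂ : ∀ x, HasDerivAt (fun y => 2 * ρ y + 4 * y * ρ₁ y + y ^ 2 * ρ₂ y)
      (6 * ρ₁ x + 6 * x * ρ₂ x + x ^ 2 * ρ₃ x) x := fun x => by
    refine ((((hρ.hasDerivAt x).const_mul 2).add
      (((hasDerivAt_id x).const_mul 4).mul (hρ.hasDerivAt₁ x))).add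
      (((hasDerivAt_id x).pow 2).mul (hρ.hasDerivAt₂ x))).congr_deriv ?_
    simp
    ring
  have s₀ : HasCompactSupport fun y => y ^ 2 * ρ y := by
    have := hρ.hasCompactSupport one_pos
    simp only [div_one] at this
    exact this.mul_left
  have s₁ := s₀.deriv
  rw [funext fun x => (d₀ x).deriv] at s₁
  have s₂ := s₁.deriv
  rw [funext fun x => (d₁ x).deriv] at s₂
  have s₃ := s₂.deriv
  rw [funext fun x => (d₂ x).deriv] at s₃
  obtain ⟨B₂, hB₂⟩ := s₂.exists_bound_of_continuous
    (continuous_iff_continuousAt.2 fun x => (d₂ x).continuousAt)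
  obtain ⟨B₃, hB₃⟩ := s₃.exists_bound_of_continuous (by fun_prop)
  have p₂ : 0 ≤ B₂ := (norm_nonneg _).trans (hB₂ 0)
  have p₃ : 0 ≤ B₃ := (norm_nonneg _).trans (hB₃ 0)
  have hU : ∀ x : ℝ, |x| < 1 → ∀ᶠ y in nhds x, |y| < 1 := fun x hx =>
    (isOpen_lt continuous_abs continuous_const).mem_nhds hx
  refine ⟨_, _, _, _, B₂ + B₃ + 1, by positivity, d₀, d₁, d₂, by fun_prop, s₀, fun x => ?_,
    fun x hx => by rw [hρ.eq_one x hx, mul_one], fun x hx => ?_,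
    fun x => (hB₂ x).trans (by linarith), fun x => (hB₃ x).trans (by linarith)⟩
  · rw [abs_mul, abs_of_nonneg (sq_nonneg x), abs_of_nonneg (hρ.nonneg x)]
    exact mul_le_of_le_one_right (sq_nonneg x) (hρ.le_one x)
  · have e₁ : ∀ y : ℝ, |y| < 1 → 2 * y * ρ y + y ^ 2 * ρ₁ y = 2 * y := fun y hy => by
      refine ((d₀ y).congr_of_eventuallyEq (f₁ := fun z => z ^ 2) ?_).unique (by
        simpa using hasDerivAt_pow 2 y)
      filter_upwards [hU y hy] with z hz
      rw [hρ.eq_one z hz.le, mul_one]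
    refine ((d₁ x).congr_of_eventuallyEq (f₁ := fun z => 2 * z) ?_).unique (by
        simpa using (hasDerivAt_id x).const_mul 2)
    filter_upwards [hU x hx] with z hz
    rw [e₁ z hz]

section Moment

variable {p C : ℝ} {φ φ₁ φ₂ φ₃ ρ ρ₁ ρ₂ ρ₃ : ℝ → ℝ}

theorem IsProfile.moment_identity {u a w w₁ w₂ v : ℝ → ℝ} (h : IsProfile p u a w w₁ w₂ v)
    (hφ : ∀ x, HasDerivAt φ (φ₁ x) x) (hφ₁ : ∀ x, HasDerivAt φ₁ (φ₂ x) x)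
    (hφ₂ : ∀ x, HasDerivAt φ₂ (φ₃ x) x) (hφ₃ : Continuous φ₃) (hs : HasCompactSupport φ) :
    ∫ x, φ x * -v x = ∫ x, (φ₃ x * (u x * a x * w x) + p * (φ₂ x * (u x * w x ^ 2))) := by
  have cu := h.continuous_u
  have ca := h.continuous_a
  have cw := h.continuous_w
  have cw₁ := h.continuous_w₁
  have cw₂ := h.continuous_w₂
  have cv := h.continuous_v
  have cφ : Continuous φ := continuous_iff_continuousAt.2 fun x => (hφ x).continuousAt
  have cφ₁ : Continuous φ₁ := continuous_iff_continuousAt.2 fun x => (hφ₁ x).continuousAt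
  have cφ₂ : Continuous φ₂ := continuous_iff_continuousAt.2 fun x => (hφ₂ x).continuousAt
  have hs₁ : HasCompactSupport φ₁ := (funext fun x => (hφ x).deriv : deriv φ = φ₁) ▸ hs.deriv
  have hs₂ : HasCompactSupport φ₂ := (funext fun x => (hφ₁ x).deriv : deriv φ₁ = φ₂) ▸ hs₁.deriv
  have hs₃ : HasCompactSupport φ₃ := (funext fun x => (hφ₂ x).deriv : deriv φ₂ = φ₃) ▸ hs₂.deriv
  have hI1 : Integrable fun x => φ x * -v x :=
    Continuous.integrable_of_hasCompactSupport (by fun_prop) hs.mul_right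
  have hI2 : Integrable fun x => φ₃ x * (u x * a x * w x) + p * (φ₂ x * (u x * w x ^ 2)) :=
    Continuous.integrable_of_hasCompactSupport (by fun_prop) (hs₃.mul_right.add hs₂.mul_right.mul_left)
  have hI3 : Integrable fun y => φ₁ y * (u y * a y * w₁ y)
      - φ y * (u y * (a y * w₂ y + p * (w y * w₁ y))) - φ₂ y * (u y * a y * w y) :=
    Continuous.integrable_of_hasCompactSupport (by fun_prop)
      ((hs₁.mul_right.sub hs.mul_right).sub hs₂.mul_right)
  have key := integral_eq_zero_of_hasDerivAt_of_integrable
    (f' := fun x => φ x * -v x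
      - (φ₃ x * (u x * a x * w x) + p * (φ₂ x * (u x * w x ^ 2))))
    (fun x => ((((hφ₁ x).mul (h.hasDerivAt_pressure x)).sub
      ((hφ x).mul (h.hasDerivAt_flux x))).sub
      ((hφ₂ x).mul ((h.hasDerivAt_ua x).mul (h.hasDerivAt_w x)))).congr_deriv ?_)
    (hI1.sub hI2) hI3
  · rw [integral_sub hI1 hI2] at key
    linarith
  · simp only [Pi.mul_apply]
    ring

theorem IsProfile.moment_rate_le {u a w w₁ w₂ v : ℝ → ℝ} (h : IsProfile p u a w w₁ w₂ v)
    (hp : 0 ≤ p) (hfish : Integrable fun x => u x * w x ^ 2) {S E B N : ℝ} (hS : ∀ x, a x ≤ S)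
    (hN : 0 ≤ N)
    (hφ : ∀ x, HasDerivAt φ (φ₁ x) x) (hφ₁ : ∀ x, HasDerivAt φ₁ (φ₂ x) x)
    (hφ₂ : ∀ x, HasDerivAt φ₂ (φ₃ x) x) (hφ₃ : Continuous φ₃) (hs : HasCompactSupport φ)
    (hb₃ : ∀ x, |φ₃ x| ≤ N) {η : ℝ → ℝ} (hη : Continuous η) (hηE : ∀ x, |η x| ≤ E)
    (hb₂ : ∀ x, |φ₂ x - 2| ≤ B * η x) :
    |(∫ x, φ x * -v x) - 2 * p * ∫ x, u x * w x ^ 2| ≤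
      N * S * (1 + ∫ x, u x * w x ^ 2) + p * B * ∫ x, η x * (u x * w x ^ 2) := by
  have cu := h.continuous_u
  have ca := h.continuous_a
  have cw := h.continuous_w
  have cφ₂ : Continuous φ₂ := continuous_iff_continuousAt.2 fun x => (hφ₂ x).continuousAt
  have hs₁ : HasCompactSupport φ₁ := (funext fun x => (hφ x).deriv : deriv φ = φ₁) ▸ hs.deriv
  have hs₂ : HasCompactSupport φ₂ := (funext fun x => (hφ₁ x).deriv : deriv φ₁ = φ₂) ▸ hs₁.deriv
  have hs₃ : HasCompactSupport φ₃ := (funext fun x => (hφ₂ x).deriv : deriv φ₂ = φ₃) ▸ hs₂.deriv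
  have hI2 : Integrable fun x => φ₃ x * (u x * a x * w x) + p * (φ₂ x * (u x * w x ^ 2)) :=
    Continuous.integrable_of_hasCompactSupport (by fun_prop) (hs₃.mul_right.add hs₂.mul_right.mul_left)
  have hI3 : Integrable fun x => η x * (u x * w x ^ 2) :=
    hfish.bdd_mul (c := E) hη.aestronglyMeasurable (Eventually.of_forall fun x => hηE x)
  have hI4 : Integrable fun x => N * S * (u x + u x * w x ^ 2) :=
    (h.integrable.add hfish).const_mul _
  rw [h.moment_identity hφ hφ₁ hφ₂ hφ₃ hs, ← integral_const_mul,
    ← integral_sub hI2 (hfish.const_mul _), ← Real.norm_eq_abs]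
  calc _ ≤ ∫ x, (N * S * (u x + u x * w x ^ 2) + p * B * (η x * (u x * w x ^ 2))) := by
        refine norm_integral_le_of_norm_le (hI4.add (hI3.const_mul _))
          (Eventually.of_forall fun x => ?_)
        have hu := h.pos x
        have ha := h.a_pos x
        have h1 : |φ₃ x * (u x * a x * w x)| ≤ N * S * (u x + u x * w x ^ 2) := by
          have hw : |w x| ≤ 1 + w x ^ 2 := by
            rw [← sq_abs]
            linarith [sq_nonneg (|w x| - 1), sq_nonneg (|w x|)]
          calc |φ₃ x * (u x * a x * w x)| = |φ₃ x| * (u x * a x * |w x|) := by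
                rw [abs_mul, abs_mul, abs_mul, abs_of_pos hu, abs_of_pos ha]
            _ ≤ N * (u x * S * (1 + w x ^ 2)) := by
                have := hb₃ x
                have := hS x
                have : 0 ≤ S := ha.le.trans this
                gcongr
            _ = _ := by ring
        have h2 : |p * (φ₂ x * (u x * w x ^ 2)) - 2 * p * (u x * w x ^ 2)|
            ≤ p * B * (η x * (u x * w x ^ 2)) := by
          have hn : 0 ≤ u x * w x ^ 2 := by positivity
          calc |p * (φ₂ x * (u x * w x ^ 2)) - 2 * p * (u x * w x ^ 2)|
              = |p * (u x * w x ^ 2) * (φ₂ x - 2)| := by congr 1; ring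
            _ = p * (u x * w x ^ 2) * |φ₂ x - 2| := by
                rw [abs_mul, abs_of_nonneg (by positivity)]
            _ ≤ p * (u x * w x ^ 2) * (B * η x) := by
                have := hb₂ x
                gcongr
            _ = _ := by ring
        rw [add_sub_assoc]
        exact (norm_add_le _ _).trans (add_le_add h1 h2)
    _ = _ := by
        rw [integral_add hI4 (hI3.const_mul _), integral_const_mul, integral_const_mul,
          integral_add h.integrable hfish, h.integral_eq]

end Moment

set_option maxHeartbeats 800000 in
theorem IsFlow.hasDerivAt_second_moment {p T : ℝ} {u a w w₁ w₂ v wt : ℝ → ℝ → ℝ}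
    (h : IsFlow p T u a w w₁ w₂ v wt) (hp : 1 ≤ p)
    (hfish : ∀ t ∈ Ioo 0 T, Integrable fun x => u t x * w t x ^ 2)
    (hmom : ∀ t ∈ Ioo 0 T, Integrable fun x => x ^ 2 * u t x) {t : ℝ} (ht : t ∈ Ioo 0 T) :
    HasDerivAt (fun s => ∫ x, x ^ 2 * u s x) (2 * p * ∫ x, u t x * w t x ^ 2) t := by
  obtain ⟨C, ρ, ρ₁, ρ₂, ρ₃, hC, hρ⟩ := exists_isBump
  obtain ⟨ψ, ψ₁, ψ₂, ψ₃, B, hB, d₀, d₁, d₂, c₃, hs, hψ, hψeq, hψ₂, hB₂, hB₃⟩ :=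
    hρ.exists_truncated_square
  obtain ⟨q, hq⟩ := exists_nat_ge (p - 1)
  obtain ⟨K, R₀, hK, hR₀, hE⟩ := fisher_antitone_and_tail_le hp hq hρ
  have cρ := hρ.continuous
  have cψ : Continuous ψ := continuous_iff_continuousAt.2 fun x => (d₀ x).continuousAt
  have ht₀ : t / 2 ∈ Ioo 0 T := ⟨by linarith [ht.1], by linarith [ht.1, ht.2]⟩
  have hsub : ∀ s ∈ Ioo (t / 2) T, s ∈ Ioo 0 T := fun s hs => ⟨ht₀.1.trans hs.1, hs.2⟩
  set W₀ := ∫ x, u (t / 2) x * w (t / 2) x ^ 2 with hW₀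
  have hW₀0 : 0 ≤ W₀ := integral_nonneg fun x => by
    have := (h.profile _ ht₀).pos x
    positivity
  set S := (2 + 2 * p) * (1 + √W₀) with hS
  have hS0 : 0 ≤ S := by positivity
  have hge : ∀ r : ℝ, ∀ᶠ n : ℕ in atTop, r ≤ n := fun r =>
    tendsto_natCast_atTop_atTop.eventually_ge_atTop r
  set tail : ℕ → ℝ := fun n =>
    ∫ x, (1 - ρ (x / n)) ^ (8 * q + 8) * (u (t / 2) x * w (t / 2) x ^ 2) with htail
  set bound : ℕ → ℝ := fun n => B / (2 * n) * S * (1 + W₀)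
    + p * (B + 2) * (tail n + K * (2 * C / n) ^ 2 * T) with hbound
  have hb0 : Tendsto bound atTop (nhds 0) := by
    have i1 : Tendsto (fun n : ℕ => B / (2 * n)) atTop (nhds 0) := by
      have := tendsto_const_div_atTop_nhds_zero_nat (B / 2)
      refine this.congr fun n => ?_
      rw [div_div]
    have i2 : Tendsto tail atTop (nhds 0) := by
      have := tendsto_integral_pow_mul (hfish _ ht₀) (8 * q + 8)
        (χ := fun n x => 1 - ρ (x / n)) (χ' := fun _ => 0)
        (Eventually.of_forall fun n => by fun_prop)
        (Eventually.of_forall fun n x => by linarith [hρ.le_one (x / n)])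
        (Eventually.of_forall fun n x => by linarith [hρ.nonneg (x / n)])
        (fun x => by simpa using (hρ.tendsto x).const_sub 1)
      simpa using this
    have i3 := ((tendsto_const_div_atTop_nhds_zero_nat (2 * C)).pow 2).const_mul K |>.mul_const T
    have := ((i1.mul_const S).mul_const (1 + W₀)).add ((i2.add i3).const_mul (p * (B + 2)))
    simpa using this
  have hdφ : ∀ N : ℝ, N ≠ 0 → (∀ x, HasDerivAt (fun y => N ^ 2 * ψ (y / N)) (N * ψ₁ (x / N)) x) ∧
      (∀ x, HasDerivAt (fun y => N * ψ₁ (y / N)) (ψ₂ (x / N)) x) ∧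
      ∀ x, HasDerivAt (fun y => ψ₂ (y / N)) (ψ₃ (x / N) / N) x := fun N hN => by
    refine ⟨fun x => ?_, fun x => ?_, hasDerivAt_comp_div d₂ N⟩
    · refine ((hasDerivAt_comp_div d₀ N x).const_mul (N ^ 2)).congr_deriv ?_
      field_simp
    · refine ((hasDerivAt_comp_div d₁ N x).const_mul N).congr_deriv ?_
      field_simp
  have hcs : ∀ N : ℝ, N ≠ 0 → HasCompactSupport fun y => N ^ 2 * ψ (y / N) := fun N hN =>
    HasCompactSupport.mul_left (by
      simpa only [Function.comp_def, div_eq_mul_inv, Homeomorph.coe_mulRight₀] using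
        hs.comp_homeomorph (Homeomorph.mulRight₀ N⁻¹ (inv_ne_zero hN)))
  refine hasDerivAt_of_tendstoUniformlyOn (l := atTop) (s := Ioo (t / 2) T) isOpen_Ioo
    (f := fun (n : ℕ) s => ∫ x, (2 * n : ℝ) ^ 2 * ψ (x / (2 * n)) * u s x)
    (f' := fun (n : ℕ) s => ∫ x, (2 * n : ℝ) ^ 2 * ψ (x / (2 * n)) * -v s x)
    (g' := fun s => 2 * p * ∫ x, u s x * w s x ^ 2) ?_ ?_ ?_ ⟨by linarith [ht.1], ht.2⟩
  · rw [Metric.tendstoUniformlyOn_iff]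
    intro ε hε
    filter_upwards [hb0.eventually_lt_const hε, hge R₀] with n hn hnR s hs'
    have hn1 : (1 : ℝ) ≤ n := hR₀.trans hnR
    have hn0 : (2 * n : ℝ) ≠ 0 := by positivity
    have hs0 := hsub s hs'
    have hP := h.profile s hs0
    obtain ⟨hfi, hta⟩ := hE T u a w w₁ w₂ v wt h hfish _ ht₀ s hs0 hs'.1.le
    have hsup := hP.sup_le hp hρ (hfish s hs0) (τ := 1 + √W₀)
      (by linarith [Real.sqrt_nonneg W₀]) (hfi.trans (by
        have := Real.sq_sqrt hW₀0
        linarith [Real.sqrt_nonneg W₀]))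
    obtain ⟨e₁, e₂, e₃⟩ := hdφ (2 * n) hn0
    have := hP.moment_rate_le (by linarith) (hfish s hs0) hsup (N := B / (2 * n)) (B := B + 2)
      (E := 1) (by positivity) e₁ e₂ e₃ (by fun_prop) (hcs _ hn0)
      (fun x => by
        rw [abs_div, abs_of_nonneg (show (0:ℝ) ≤ 2 * n by positivity)]
        have := hB₃ (x / (2 * n))
        gcongr)
      (η := fun x => (1 - ρ (x / n)) ^ (8 * q + 8)) (by fun_prop)
      (fun x => by
        have i1 : 0 ≤ 1 - ρ (x / n) := by linarith [hρ.le_one (x / n)]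
        rw [abs_of_nonneg (by positivity)]
        exact pow_le_one₀ i1 (by linarith [hρ.nonneg (x / n)]))
      (fun x => by
        have i1 : 0 ≤ 1 - ρ (x / n) := by linarith [hρ.le_one (x / n)]
        rcases lt_or_ge |x / (2 * n)| 1 with hx | hx
        · rw [hψ₂ _ hx, sub_self, abs_zero]
          positivity
        · have : ρ (x / n) = 0 := by
            apply hρ.eq_zero
            rw [abs_div, abs_of_pos (by positivity : (0:ℝ) < 2 * n),
              le_div_iff₀ (by positivity)] at hx
            rw [abs_div, abs_of_pos (by positivity : (0:ℝ) < n), le_div_iff₀ (by positivity)]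
            linarith
          rw [this]
          have := abs_le.1 (hB₂ (x / (2 * n)))
          rw [sub_zero, one_pow, mul_one, abs_le]
          constructor <;> linarith [this.1, this.2])
    rw [dist_comm, Real.dist_eq]
    refine this.trans_lt (lt_of_le_of_lt ?_ hn)
    have hta' := hta n hnR
    have i5 : K * (2 * C / n) ^ 2 * (s - t / 2) ≤ K * (2 * C / n) ^ 2 * T := by
      gcongr
      linarith [hs'.2, ht₀.1]
    simp only [hbound]
    gcongr
    simp only [htail]
    linarith
  · filter_upwards [hge 1] with n hn s hs'
    have hn0 : (2 * n : ℝ) ≠ 0 := by positivity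
    exact hasDerivAt_integral_mul (by fun_prop) (hcs _ hn0) h.continuousOn_u h.continuousOn_v.neg
      h.hasDerivAt_u (hsub s hs')
  · intro s hs'
    have hP := h.profile s (hsub s hs')
    have cu := hP.continuous_u
    refine tendsto_integral_of_dominated_convergence (fun x => x ^ 2 * u s x)
      (fun n => Continuous.aestronglyMeasurable (by fun_prop)) (hmom s (hsub s hs'))
      (fun n => Eventually.of_forall fun x => ?_) (Eventually.of_forall fun x => ?_)
    · have hu := hP.pos x
      rw [norm_mul, norm_mul, Real.norm_of_nonneg hu.le, Real.norm_of_nonneg (sq_nonneg _)]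
      gcongr
      rcases eq_or_ne (2 * n : ℝ) 0 with h0 | h0
      · rw [h0]
        simpa using sq_nonneg x
      · calc (2 * n : ℝ) ^ 2 * ‖ψ (x / (2 * n))‖ ≤ (2 * n : ℝ) ^ 2 * (x / (2 * n)) ^ 2 := by
              gcongr
              exact hψ _
          _ = x ^ 2 := by rw [← mul_pow, mul_div_cancel₀ _ h0]
    · refine tendsto_const_nhds.congr' ?_
      filter_upwards [hge 1, hge |x|] with n h1 h2
      rw [hψeq]
      · field_simp
      · rw [abs_div, abs_of_pos (by positivity : (0:ℝ) < 2 * n), div_le_one (by positivity)]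
        linarith

/-- along smooth positive rapidly decaying solutions of
`∂_t u = −∂_x²(u^p ∂_x²(ln_p u))`, the second moment `Θ(t) = ∫ x² u dx` is
differentiable with `Θ'(t) = 4p I_p(u(·,t)) = 2p ∫ u ((ln_p u)')² dx`. -/
theorem second_moment_evolution
    (p : ℝ) (hp : 1 ≤ p) (T : ℝ) (hT : 0 < T)
    (u : ℝ → ℝ → ℝ)
    (hsmooth : ContDiffOn ℝ (⊤ : ℕ∞) (Function.uncurry u) (univ ×ˢ Ioo 0 T))
    (hpos : ∀ x t, t ∈ Ioo 0 T → 0 < u x t)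
    (hpde : ∀ x t, t ∈ Ioo 0 T →
      deriv (fun s => u x s) t =
        - deriv (deriv (fun z =>
            (u z t) ^ p * deriv (deriv (fun w => lnp p (u w t))) z)) x)
    (hdens : ∀ t ∈ Ioo 0 T,
      Integrable (fun x => u x t) ∧ (∫ x : ℝ, u x t) = 1)
    (hdecay : ∀ t ∈ Ioo 0 T, RapidDecay (fun x => u x t))
    (hmom : ∀ t ∈ Ioo 0 T, Integrable (fun x => x ^ 2 * u x t)) :
    ∀ t ∈ Ioo 0 T,
      HasDerivAt (fun s => ∫ x : ℝ, x ^ 2 * u x s)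
        (4 * p * fisherP p (fun x => u x t)) t ∧
      4 * p * fisherP p (fun x => u x t) =
        2 * p * ∫ x : ℝ, u x t * (deriv (fun z => lnp p (u z t)) x) ^ 2 := by
  intro t ht
  obtain ⟨a, w, w₁, w₂, v, wt, h, hw⟩ := exists_isFlow hsmooth hpos hpde hdens
  have hfish : ∀ t ∈ Ioo 0 T, Integrable fun x => u x t * w t x ^ 2 := fun t ht =>
    (h.profile t ht).integrable_fisher hp (hdecay t ht)
  have e : 4 * p * fisherP p (fun x => u x t) =
      2 * p * ∫ x : ℝ, u x t * (deriv (fun z => lnp p (u z t)) x) ^ 2 := by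
    rw [fisherP]
    ring
  refine ⟨?_, e⟩
  rw [e]
  simp only [hw t ht]
  exact h.hasDerivAt_second_moment hp hfish hmom ht
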